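/- arXiv:2312.16795 — 9 statements merged into one kernel-verified Lean document; each statement's English description precedes it below -/
import Mathlib

section
/- Let G be a simple graph of order n ≥ 4. If q(G) ≥ (1/2)(n+2+√((n-2)²+8)) when n is odd, or q(G) ≥ (1/2)(n+1+√((n-1)²+8)) when n is even, then G contains a chorded cycle, unless G is isomorphic to F_n. -/
open SimpleGraph Finset

/-- The signless Laplacian matrix `Q(G) = D(G) + A(G)` of a finite simple graph. -/
noncomputable def signlessLapMatrix {V : Type*} [Fintype V] [DecidableEq V]
    (G : SimpleGraph V) : Matrix V V ℝ :=
  letI := Classical.decRel G.Adj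
  Matrix.diagonal (fun v => (G.degree v : ℝ)) + G.adjMatrix ℝ

/-- The signless Laplacian spectral radius `q(G)`: the largest eigenvalue of `Q(G)`. -/
noncomputable def qSpecRad {V : Type*} [Fintype V] [DecidableEq V]
    (G : SimpleGraph V) : ℝ :=
  sSup (spectrum ℝ (signlessLapMatrix G))

/-- The largest Laplacian eigenvalue `μ(G)`. -/
noncomputable def muSpecRad {V : Type*} [Fintype V] [DecidableEq V]
    (G : SimpleGraph V) : ℝ :=
  letI := Classical.decRel G.Adj
  sSup (spectrum ℝ (G.lapMatrix ℝ))

/-- `G` has a chorded cycle: a cycle together with an edge of `G` joining two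
vertices of the cycle which is not an edge of the cycle. -/
def HasChordedCycle {V : Type*} (G : SimpleGraph V) : Prop :=
  ∃ (v : V) (C : G.Walk v v), C.IsCycle ∧
    ∃ a b : V, a ∈ C.support ∧ b ∈ C.support ∧ G.Adj a b ∧ s(a, b) ∉ C.edges

/-- `F_{n,c}`: the star `K_{1,n-1}` with center `0` together with `c` pairwise
nonadjacent edges among the leaves, namely the edges `(2k+1, 2k+2)` for `k < c`. -/
def Fgraph (n c : ℕ) : SimpleGraph (Fin n) :=
  SimpleGraph.fromRel (fun i j =>
    i.val = 0 ∨ (j.val = i.val + 1 ∧ j.val % 2 = 0 ∧ j.val ≤ 2 * c))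

/-- `H^{(n)}_{a₁,a₂,b₁,b₂}` (for `n = 3 + a₁ + 2a₂ + b₁ + 2b₂`): a triangle `u v w`
(vertices `0, 1, 2`), with `a₁` pendant edges and `a₂` triangles attached at `u = 0`,
and `b₁` pendant edges and `b₂` triangles attached at `v = 1`. -/
def Hgraph (n a₁ a₂ b₁ b₂ : ℕ) : SimpleGraph (Fin n) :=
  SimpleGraph.fromRel (fun x y =>
    (x.val = 0 ∧ y.val = 1) ∨ (x.val = 0 ∧ y.val = 2) ∨ (x.val = 1 ∧ y.val = 2) ∨
    (x.val = 0 ∧ 3 ≤ y.val ∧ y.val < 3 + a₁ + 2 * a₂) ∨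
    (3 + a₁ ≤ x.val ∧ y.val = x.val + 1 ∧ (x.val - (3 + a₁)) % 2 = 0 ∧
      y.val < 3 + a₁ + 2 * a₂) ∨
    (x.val = 1 ∧ 3 + a₁ + 2 * a₂ ≤ y.val ∧ y.val < 3 + a₁ + 2 * a₂ + b₁ + 2 * b₂) ∨
    (3 + a₁ + 2 * a₂ + b₁ ≤ x.val ∧ y.val = x.val + 1 ∧
      (x.val - (3 + a₁ + 2 * a₂ + b₁)) % 2 = 0 ∧
      y.val < 3 + a₁ + 2 * a₂ + b₁ + 2 * b₂))

/-- `G` is a regular graph. -/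
def IsRegularGraph {V : Type*} [Fintype V] (G : SimpleGraph V) : Prop :=
  letI := Classical.decRel G.Adj
  ∃ d, G.IsRegularOfDegree d

/-- `G` is a semi-regular bipartite graph: there is a bipartition such that every edge
crosses it and vertices in the same part all have the same degree. -/
def IsSemiregularBipartite {V : Type*} [Fintype V] (G : SimpleGraph V) : Prop :=
  letI := Classical.decRel G.Adj
  ∃ (s : Set V) (d₁ d₂ : ℕ),
    (∀ ⦃a b⦄, G.Adj a b → (a ∈ s ↔ b ∉ s)) ∧
    (∀ a ∈ s, G.degree a = d₁) ∧ (∀ a ∉ s, G.degree a = d₂)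

theorem hasChordedCycle_of_four_cycle {V : Type*} {G : SimpleGraph V} {a b c d : V}
    (hab : G.Adj a b) (hbc : G.Adj b c) (hcd : G.Adj c d) (hda : G.Adj d a)
    (hac : G.Adj a c) (hbd : b ≠ d) : HasChordedCycle G := by
  refine ⟨a, .cons hab (.cons hbc (.cons hcd (.cons hda .nil))), ?_, a, c, ?_, ?_, hac, ?_⟩
  · have h1 := hab.ne
    have h2 := hbc.ne
    have h3 := hcd.ne
    have h4 := hda.ne
    have h5 := hac.ne
    rw [Walk.cons_isCycle_iff]
    simp
    grind
  · simp
  · simp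
  · have h1 := hab.ne
    have h2 := hbc.ne
    have h3 := hcd.ne
    have h4 := hda.ne
    have h5 := hac.ne
    simp
    grind

theorem hasChordedCycle_of_five_cycle {V : Type*} {G : SimpleGraph V} {a b c d e : V}
    (hab : G.Adj a b) (hbc : G.Adj b c) (hcd : G.Adj c d) (hde : G.Adj d e) (hea : G.Adj e a)
    (hac : G.Adj a c) (hbd : b ≠ d) (hbe : b ≠ e) (hce : c ≠ e) (had : a ≠ d) :
    HasChordedCycle G := by
  refine ⟨a, .cons hab (.cons hbc (.cons hcd (.cons hde (.cons hea .nil)))), ?_,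
    a, c, ?_, ?_, hac, ?_⟩
  · have h1 := hab.ne
    have h2 := hbc.ne
    have h3 := hcd.ne
    have h4 := hde.ne
    have h5 := hac.ne
    have h6 := hea.ne
    rw [Walk.cons_isCycle_iff]
    simp
    grind
  · simp
  · simp
  · have h1 := hab.ne
    have h2 := hbc.ne
    have h3 := hcd.ne
    have h4 := hde.ne
    have h5 := hac.ne
    have h6 := hea.ne
    simp
    grind

theorem signlessLapMatrix_mulVec {V : Type*} [Fintype V] [DecidableEq V] (G : SimpleGraph V)
    [DecidableRel G.Adj] (x : V → ℝ) (u : V) :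
    (signlessLapMatrix G).mulVec x u = ∑ v ∈ G.neighborFinset u, (x u + x v) := by
  have h : signlessLapMatrix G =
      Matrix.diagonal (fun v => (G.degree v : ℝ)) + G.adjMatrix ℝ := by
    unfold signlessLapMatrix
    congr!
  rw [h, Matrix.add_mulVec, Pi.add_apply, Matrix.mulVec_diagonal, adjMatrix_mulVec_apply,
    Finset.sum_add_distrib, Finset.sum_const, card_neighborFinset_eq_degree, nsmul_eq_mul]

theorem qSpecRad_lt {V : Type*} [Fintype V] [DecidableEq V] (G : SimpleGraph V)
    [DecidableRel G.Adj] {r : ℝ} (hr : 0 < r) (x : V → ℝ) (hx : ∀ v, 0 < x v)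
    (h : ∀ u, ∑ v ∈ G.neighborFinset u, (x u + x v) < r * x u) : qSpecRad G < r := by
  unfold qSpecRad
  rcases (spectrum ℝ (signlessLapMatrix G)).eq_empty_or_nonempty with h0 | h0
  · rwa [h0, Real.sSup_empty]
  have hmem := h0.csSup_mem (Matrix.finite_spectrum (signlessLapMatrix G))
  set l := sSup (spectrum ℝ (signlessLapMatrix G))
  rw [spectrum.mem_iff, Matrix.isUnit_iff_isUnit_det, isUnit_iff_ne_zero, not_not,
    ← Matrix.exists_mulVec_eq_zero_iff] at hmem
  obtain ⟨f, hf, hfl⟩ := hmem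
  have key : ∀ u, l * f u = ∑ v ∈ G.neighborFinset u, (f u + f v) := by
    intro u
    have h1 := congrFun hfl u
    rw [Matrix.sub_mulVec, Pi.sub_apply, signlessLapMatrix_mulVec, Algebra.algebraMap_eq_smul_one,
      Matrix.smul_mulVec, Matrix.one_mulVec] at h1
    simpa [sub_eq_zero] using h1
  obtain ⟨w, hw⟩ := Function.ne_iff.mp hf
  obtain ⟨u, -, hu⟩ := Finset.exists_max_image univ (fun v => |f v| / x v) ⟨w, mem_univ w⟩
  set c := |f u| / x u with hc
  have hfv : ∀ v, |f v| ≤ c * x v := fun v => (div_le_iff₀ (hx v)).mp (hu v (mem_univ v))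
  have hcpos : 0 < c := by
    have : 0 < |f w| / x w := div_pos (abs_pos.mpr hw) (hx w)
    exact this.trans_le (hu w (mem_univ w))
  have hfu : |f u| = c * x u := by rw [hc, div_mul_cancel₀ _ (hx u).ne']
  have h2 : |l| * (c * x u) ≤ c * ∑ v ∈ G.neighborFinset u, (x u + x v) := by
    rw [← hfu, ← abs_mul, key u, Finset.mul_sum]
    refine (Finset.abs_sum_le_sum_abs _ _).trans (Finset.sum_le_sum fun v _ => ?_)
    calc |f u + f v| ≤ |f u| + |f v| := abs_add_le _ _
      _ ≤ c * (x u + x v) := by linarith [hfv u, hfv v]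
  have h3 : |l| * (c * x u) < r * (c * x u) := by
    have := mul_lt_mul_of_pos_left (h u) hcpos
    linarith
  exact (le_abs_self l).trans_lt (lt_of_mul_lt_mul_right h3 (mul_pos hcpos (hx u)).le)

theorem sum_degree_neighborFinset_le {V : Type*} [Fintype V] [DecidableEq V] (G : SimpleGraph V)
    [DecidableRel G.Adj] (hG : ¬ HasChordedCycle G) (u : V) {b : ℕ} (hb : 1 ≤ b)
    (hcard : Fintype.card V = G.degree u + 1 + b) :
    ∑ v ∈ G.neighborFinset u, G.degree v ≤
      G.degree u + G.degree u * b + if b = 1 then 1 else 0 := by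
  set N := G.neighborFinset u with hN
  set W := (insert u N)ᶜ with hW
  have hmemN : ∀ v, v ∈ N ↔ G.Adj u v := fun v => by simp [hN]
  have hmemW : ∀ v, v ∈ W ↔ v ≠ u ∧ ¬ G.Adj u v := fun v => by simp [hW, hmemN]
  have huN : u ∉ N := by simp [hmemN]
  have hNcard : #N = G.degree u := G.card_neighborFinset_eq_degree u
  have hWcard : #W = b := by
    rw [hW, card_compl, card_insert_of_notMem huN]
    omega
  set T := {v ∈ N | ∃ v' ∈ N, G.Adj v v'} with hT
  have hTN : T ⊆ N := filter_subset _ _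
  have huniq : ∀ v ∈ N, ∀ x ∈ N, ∀ y ∈ N, G.Adj v x → G.Adj v y → x = y := by
    intro v hv x hx y hy hvx hvy
    rw [hmemN] at hv hx hy
    by_contra hxy
    exact hG (hasChordedCycle_of_four_cycle hx hvx.symm hvy hy.symm hv hxy)
  have hdeg : ∀ v ∈ N, G.degree v ≤ 1 + (if v ∈ T then 1 else 0) + #{w ∈ W | G.Adj v w} := by
    intro v hv
    have hsub : G.neighborFinset v ⊆ insert u ({x ∈ N | G.Adj v x} ∪ {w ∈ W | G.Adj v w}) := by
      intro x hx
      simp only [mem_neighborFinset] at hx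
      simp only [mem_insert, mem_union, mem_filter, hmemN, hmemW]
      tauto
    have h1 : #{x ∈ N | G.Adj v x} ≤ if v ∈ T then 1 else 0 := by
      split_ifs with h
      · rw [card_le_one]
        simp only [mem_filter]
        exact fun x hx y hy => huniq v hv x hx.1 y hy.1 hx.2 hy.2
      · rw [Nat.le_zero, card_eq_zero, filter_eq_empty_iff]
        exact fun x hx hvx => h (mem_filter.mpr ⟨hv, x, hx, hvx⟩)
    have h2 := (card_le_card hsub).trans (card_insert_le _ _)
    have h3 := card_union_le {x ∈ N | G.Adj v x} {w ∈ W | G.Adj v w}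
    rw [card_neighborFinset_eq_degree] at h2
    omega
  have hcount : ∑ v ∈ N, G.degree v ≤ #N + #T + ∑ w ∈ W, #{v ∈ N | G.Adj v w} := by
    refine (sum_le_sum hdeg).trans_eq ?_
    have hswap := sum_card_bipartiteAbove_eq_sum_card_bipartiteBelow (s := N) (t := W) G.Adj
    simp only [bipartiteAbove, bipartiteBelow] at hswap
    rw [sum_add_distrib, sum_add_distrib, hswap]
    simp only [sum_const, smul_eq_mul, mul_one, ← card_filter, filter_mem_eq_inter,
      inter_eq_right.mpr hTN]
  have hw : ∀ w ∈ W, #T + #{v ∈ N | G.Adj v w} ≤ #N + 1 := by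
    intro w hw
    rw [hmemW] at hw
    by_cases hdis : Disjoint T {v ∈ N | G.Adj v w}
    · rw [← card_union_of_disjoint hdis]
      exact (card_le_card (union_subset hTN (filter_subset _ _))).trans (Nat.le_succ _)
    · have h1 : #{v ∈ N | G.Adj v w} ≤ 1 := by
        obtain ⟨x, hxT, hx⟩ := not_disjoint_iff.mp hdis
        obtain ⟨hxN, y, hyN, hxy⟩ := mem_filter.mp hxT
        have hxw := (mem_filter.mp hx).2
        have hall : ∀ z ∈ {v ∈ N | G.Adj v w}, z = x := by
          intro z hz
          obtain ⟨hzN, hzw⟩ := mem_filter.mp hz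
          rw [hmemN] at hxN hyN hzN
          by_contra hzx
          by_cases hyz : y = z
          · subst hyz
            exact hG (hasChordedCycle_of_four_cycle hxN.symm hyN hzw hxw.symm hxy hw.1.symm)
          · refine hG (hasChordedCycle_of_five_cycle hyN hxy.symm hxw hzw.symm hzN.symm hxN
              ?_ hyz (Ne.symm hzx) hw.1.symm)
            rintro rfl
            exact hw.2 hyN
        exact card_le_one.mpr fun a ha c hc => (hall a ha).trans (hall c hc).symm
      have := card_le_card hTN
      omega
  have hw' : ∀ w ∈ W, #{v ∈ N | G.Adj v w} ≤ #N := fun w _ => card_le_card (filter_subset _ _)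
  have hsum := sum_le_sum hw
  have hsum' := sum_le_sum hw'
  rw [sum_add_distrib] at hsum
  simp only [sum_const, smul_eq_mul, hWcard] at hsum hsum'
  rw [hNcard] at *
  have hT2 : #T = 0 ∨ 2 ≤ #T := by
    rcases T.eq_empty_or_nonempty with h | ⟨x, hx⟩
    · simp [h]
    · right
      obtain ⟨hxN, y, hyN, hxy⟩ := mem_filter.mp hx
      exact one_lt_card.mpr ⟨x, hx, y, mem_filter.mpr ⟨hyN, x, hxN, hxy.symm⟩, hxy.ne⟩
  split_ifs with h1
  · subst h1
    linarith
  · rcases hT2 with h | h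
    · rw [h] at hcount
      linarith
    · have : 2 ≤ b := by omega
      nlinarith

theorem qSpecRad_lt_of_not_hasChordedCycle {V : Type*} [Fintype V] [DecidableEq V]
    (G : SimpleGraph V) [DecidableRel G.Adj] (hG : ¬ HasChordedCycle G)
    (hdeg : ∀ v, G.degree v + 2 ≤ Fintype.card V) {r : ℝ} (hr : (Fintype.card V : ℝ) < r)
    (hr' : 1 < (r - Fintype.card V) * (Fintype.card V - 2)) : qSpecRad G < r := by
  have hr0 : 0 < r := (Nat.cast_nonneg _).trans_lt hr
  refine qSpecRad_lt G hr0 (fun v => if G.degree v = 0 then 1 else (G.degree v : ℝ)) ?_ ?_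
  · intro v
    split_ifs with h
    · exact one_pos
    · exact_mod_cast Nat.pos_of_ne_zero h
  · intro u
    by_cases hu : G.degree u = 0
    · have : G.neighborFinset u = ∅ := by
        rw [← card_eq_zero, card_neighborFinset_eq_degree, hu]
      simp [this, hu, hr0]
    obtain ⟨b, hb⟩ := Nat.exists_eq_add_of_le (hdeg u)
    have hcard : Fintype.card V = G.degree u + 1 + (b + 1) := by omega
    have hle := sum_degree_neighborFinset_le G hG u (by omega) hcard
    have hsum : ∑ v ∈ G.neighborFinset u, ((if G.degree u = 0 then 1 else (G.degree u : ℝ)) +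
        if G.degree v = 0 then 1 else (G.degree v : ℝ)) =
        G.degree u * G.degree u + ((∑ v ∈ G.neighborFinset u, G.degree v : ℕ) : ℝ) := by
      rw [sum_add_distrib, if_neg hu, sum_const, card_neighborFinset_eq_degree, nsmul_eq_mul]
      push_cast
      congr 1
      refine sum_congr rfl fun v hv => if_neg ?_
      rw [mem_neighborFinset] at hv
      exact ((G.degree_pos_iff_exists_adj v).mpr ⟨u, hv.symm⟩).ne'
    rw [hsum, if_neg hu]
    have hd : (1 : ℝ) ≤ G.degree u := by exact_mod_cast Nat.pos_of_ne_zero hu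
    have hc : (Fintype.card V : ℝ) = G.degree u + 1 + (b + 1) := by exact_mod_cast hcard
    by_cases hb0 : b = 0
    · subst hb0
      have : ((∑ v ∈ G.neighborFinset u, G.degree v : ℕ) : ℝ) ≤
          G.degree u + G.degree u * 1 + 1 := by exact_mod_cast hle
      push_cast at hc
      rw [hc] at hr'
      nlinarith
    · have : ((∑ v ∈ G.neighborFinset u, G.degree v : ℕ) : ℝ) ≤
          G.degree u + G.degree u * (b + 1) := by
        rw [if_neg (by omega)] at hle
        exact_mod_cast hle
      nlinarith

/-- `G` consists of a vertex `u` adjacent to all others, together with the matching given by the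
involution `σ`. -/
def IsFanOf {V : Type*} (G : SimpleGraph V) (u : V) (σ : Equiv.Perm V) : Prop :=
  σ u = u ∧ Function.Involutive σ ∧ ∀ a b, G.Adj a b ↔ a ≠ b ∧ (a = u ∨ b = u ∨ σ a = b)

theorem exists_isFanOf {V : Type*} {G : SimpleGraph V} {u : V} (hu : ∀ v, v ≠ u → G.Adj u v)
    (huniq : ∀ v x y, v ≠ u → x ≠ u → y ≠ u → G.Adj v x → G.Adj v y → x = y) :
    ∃ σ, IsFanOf G u σ := by
  classical
  have hex : ∀ v, ∃ w, (v = u → w = u) ∧ (v ≠ u → w ≠ u ∧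
      ((G.Adj v w) ∨ (w = v ∧ ∀ x, x ≠ u → ¬ G.Adj v x))) := by
    intro v
    by_cases hv : v = u
    · exact ⟨u, by simp [hv]⟩
    by_cases h : ∃ x, x ≠ u ∧ G.Adj v x
    · obtain ⟨x, hx, hvx⟩ := h
      exact ⟨x, by tauto⟩
    · push Not at h
      exact ⟨v, by tauto⟩
  choose f hfu hf using hex
  have hinv : Function.Involutive f := by
    intro v
    by_cases hv : v = u
    · rw [hfu v hv, hfu u rfl, hv]
    obtain ⟨h1, h2 | ⟨h2, -⟩⟩ := hf v hv
    · obtain ⟨h3, h4 | ⟨-, h4⟩⟩ := hf (f v) h1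
      · exact huniq (f v) _ _ h1 h3 hv h4 h2.symm
      · exact absurd h2.symm (h4 v hv)
    · rw [h2, h2]
  refine ⟨hinv.toPerm f, hfu u rfl, hinv, fun a b => ?_⟩
  rw [Function.Involutive.coe_toPerm]
  constructor
  · intro hab
    refine ⟨hab.ne, ?_⟩
    by_contra! h
    obtain ⟨ha, hb, hne⟩ := h
    obtain ⟨h1, h2 | ⟨-, h2⟩⟩ := hf a ha
    · exact hne (huniq a _ _ ha h1 hb h2 hab)
    · exact h2 b hb hab
  · rintro ⟨hab, h⟩
    by_cases ha : a = u
    · subst ha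
      exact hu b hab.symm
    by_cases hb : b = u
    · subst hb
      exact (hu a hab).symm
    have hfa : f a = b := by tauto
    obtain ⟨h1, h2 | ⟨h2, -⟩⟩ := hf a ha
    · rwa [hfa] at h2
    · exact absurd (h2.symm.trans hfa) hab

theorem IsFanOf.pow_two {V : Type*} {G : SimpleGraph V} {u : V} {σ : Equiv.Perm V}
    (h : IsFanOf G u σ) : σ ^ 2 = 1 :=
  Equiv.ext fun v => by simpa [sq] using h.2.1 v

theorem IsFanOf.nonempty_iso {V : Type*} [Fintype V] [DecidableEq V] {G H : SimpleGraph V}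
    {u w : V} {σ τ : Equiv.Perm V} (hG : IsFanOf G u σ) (hH : IsFanOf H w τ)
    (hcard : #σ.support = #τ.support) : Nonempty (G ≃g H) := by
  have hconj : IsConj σ τ := by
    rw [Equiv.Perm.isConj_iff_cycleType_eq]
    have h1 := Equiv.Perm.cycleType_of_pow_prime_eq_one (p := 2) hG.pow_two
    have h2 := Equiv.Perm.cycleType_of_pow_prime_eq_one (p := 2) hH.pow_two
    have h3 := σ.sum_cycleType
    have h4 := τ.sum_cycleType
    rw [h1, Multiset.sum_replicate, smul_eq_mul] at h3
    rw [h2, Multiset.sum_replicate, smul_eq_mul] at h4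
    rw [h1, h2]
    congr 1
    omega
  obtain ⟨g, hg⟩ := isConj_iff.mp hconj
  have hgs : ∀ v, g (σ v) = τ (g v) := fun v => by simp [← hg]
  have hgu : τ (g u) = g u := by rw [← hgs, hG.1]
  have hτw : τ w = w := hH.1
  set k : Equiv.Perm V := g.trans (Equiv.swap (g u) w) with hk
  have hku : k u = w := by simp [hk]
  have hks : ∀ v, k (σ v) = τ (k v) := by
    intro v
    simp only [hk, Equiv.trans_apply, hgs, Equiv.swap_apply_def]
    have := τ.injective.eq_iff (a := g v) (b := g u)
    have := τ.injective.eq_iff (a := g v) (b := w)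
    grind
  refine ⟨⟨k, fun {a b} => ?_⟩⟩
  rw [hG.2.2, hH.2.2, ← hks, ← hku]
  simp only [ne_eq, k.injective.eq_iff]

theorem IsFanOf.qSpecRad_lt {V : Type*} [Fintype V] [DecidableEq V] {G : SimpleGraph V}
    {u : V} {σ : Equiv.Perm V} (h : IsFanOf G u σ) (hV : 4 ≤ Fintype.card V) {r : ℝ}
    (hr : (Fintype.card V : ℝ) < r)
    (hr' : 2 * (#σ.support : ℝ) <
      (r - Fintype.card V) * ((Fintype.card V - 1) * (Fintype.card V - 3))) :
    qSpecRad G < r := by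
  classical
  obtain ⟨hu, hinv, hadj⟩ := h
  set n := (Fintype.card V : ℝ) with hn
  have hn4 : 4 ≤ n := by rw [hn]; exact_mod_cast hV
  have h1 : 0 < n - 1 := by linarith
  have h3 : 0 < n - 3 := by linarith
  set x : V → ℝ := fun v => if v = u then 1 else if v ∈ σ.support then 1 / (n - 3)
    else 1 / (n - 1) with hx
  have hxu : x u = 1 := by simp [hx]
  refine _root_.qSpecRad_lt G (by linarith) x ?_ ?_
  · intro v
    simp only [hx]
    split_ifs <;> positivity
  · intro v
    by_cases hv : v = u
    · subst hv
      have hN : G.neighborFinset v = univ.erase v := by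
        ext w
        simp [hadj, eq_comm]
      have hs : σ.support ⊆ univ.erase v := fun w hw => by
        rw [mem_erase]
        refine ⟨?_, mem_univ w⟩
        rintro rfl
        exact Equiv.Perm.mem_support.mp hw hu
      have hsum : ∑ w ∈ univ.erase v, x w =
          #σ.support * (1 / (n - 3)) + (n - 1 - #σ.support) * (1 / (n - 1)) := by
        rw [← sum_sdiff hs, add_comm]
        congr 1
        · rw [sum_congr rfl (g := fun _ => 1 / (n - 3)), sum_const, nsmul_eq_mul]
          intro w hw
          have := (mem_erase.mp (hs hw)).1
          simp only [hx, if_neg this, if_pos hw]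
        · rw [sum_congr rfl (g := fun _ => 1 / (n - 1)), sum_const, nsmul_eq_mul,
            card_sdiff_of_subset hs, card_erase_of_mem (mem_univ v), card_univ,
            Nat.cast_sub, Nat.cast_sub, Nat.cast_one]
          · omega
          · have := card_le_card hs
            rwa [card_erase_of_mem (mem_univ v), card_univ] at this
          · intro w hw
            obtain ⟨hw1, hw2⟩ := mem_sdiff.mp hw
            simp only [hx, if_neg (mem_erase.mp hw1).1, if_neg hw2]
      rw [hN, sum_add_distrib, hsum, sum_const, card_erase_of_mem (mem_univ v), card_univ, hxu,
        nsmul_eq_mul, Nat.cast_sub (by omega), ← hn]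
      have : 2 * (#σ.support : ℝ) / ((n - 1) * (n - 3)) < r - n := by
        rwa [div_lt_iff₀ (mul_pos h1 h3)]
      have heq : (n - (1 : ℕ)) * 1 + (#σ.support * (1 / (n - 3)) +
          (n - 1 - #σ.support) * (1 / (n - 1))) =
          n + 2 * (#σ.support : ℝ) / ((n - 1) * (n - 3)) := by
        push_cast
        field_simp
        ring
      rw [heq]
      linarith
    by_cases hsv : v ∈ σ.support
    · have hne := Equiv.Perm.mem_support.mp hsv
      have hne' : σ v ≠ u := fun h => hv (by rw [← hinv v, h, hu])
      have hN : G.neighborFinset v = {u, σ v} := by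
        ext w
        simp only [mem_neighborFinset, hadj, mem_insert, mem_singleton]
        grind
      have hsv' : σ v ∈ σ.support := Equiv.Perm.apply_mem_support.mpr hsv
      have hxv : x v = 1 / (n - 3) := by simp only [hx, if_neg hv, if_pos hsv]
      have hxv' : x (σ v) = 1 / (n - 3) := by simp only [hx, if_neg hne', if_pos hsv']
      rw [hN, sum_pair hne'.symm, hxu, hxv, hxv', mul_one_div]
      have heq : 1 / (n - 3) + 1 + (1 / (n - 3) + 1 / (n - 3)) = n / (n - 3) := by
        field_simp
        ring
      rw [heq]
      gcongr
    · have hfix : σ v = v := Equiv.Perm.notMem_support.mp hsv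
      have hN : G.neighborFinset v = {u} := by
        ext w
        simp only [mem_neighborFinset, hadj, mem_singleton]
        grind
      have hxv : x v = 1 / (n - 1) := by simp only [hx, if_neg hv, if_neg hsv]
      rw [hN, sum_singleton, hxu, hxv, mul_one_div]
      have heq : 1 / (n - 1) + 1 = n / (n - 1) := by
        field_simp
        ring
      rw [heq]
      gcongr

theorem IsFanOf.card_support_lt {V : Type*} [Fintype V] [DecidableEq V] {G : SimpleGraph V}
    {u : V} {σ : Equiv.Perm V} (h : IsFanOf G u σ) : #σ.support < Fintype.card V := by
  refine card_lt_univ_of_notMem (x := u) ?_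
  simpa using h.1

theorem exists_isFanOf_Fgraph (n : ℕ) (hn : 4 ≤ n) :
    ∃ (u : Fin n) (τ : Equiv.Perm (Fin n)), IsFanOf (Fgraph n ((n - 1) / 2)) u τ ∧
      n ≤ #τ.support + 2 := by
  have hadj : ∀ i j : Fin n, (Fgraph n ((n - 1) / 2)).Adj i j ↔ i.val ≠ j.val ∧
      ((i.val = 0 ∨ (j.val = i.val + 1 ∧ j.val % 2 = 0 ∧ j.val ≤ 2 * ((n - 1) / 2))) ∨
      (j.val = 0 ∨ (i.val = j.val + 1 ∧ i.val % 2 = 0 ∧ i.val ≤ 2 * ((n - 1) / 2)))) := by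
    intro i j
    simp [Fgraph, Fin.ext_iff]
  let z : Fin n := ⟨0, by omega⟩
  obtain ⟨τ, hτ⟩ := exists_isFanOf (G := Fgraph n ((n - 1) / 2)) (u := z)
    (by intro v hv; simp only [hadj, z, ne_eq, Fin.ext_iff] at hv ⊢; grind)
    (by intro v x y hv hx hy; simp only [hadj, z, ne_eq, Fin.ext_iff] at hv hx hy ⊢; omega)
  refine ⟨z, τ, hτ, ?_⟩
  have hmove : ∀ i j : Fin n, i ≠ z → j ≠ z → (Fgraph n ((n - 1) / 2)).Adj i j →
      i ∈ τ.support := by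
    intro i j hi hj hij
    obtain ⟨hne, h | h | h⟩ := (hτ.2.2 i j).mp hij
    · exact absurd h hi
    · exact absurd h hj
    · rw [Equiv.Perm.mem_support, h]
      exact hne.symm
  have hsub : τ.supportᶜ ⊆ {z, ⟨n - 1, by omega⟩} := by
    intro i hi
    by_contra hi'
    rw [mem_compl] at hi
    simp only [mem_insert, mem_singleton, not_or] at hi'
    obtain ⟨h0, h1⟩ := hi'
    simp only [z, Fin.ext_iff] at h0 h1
    have hin := i.isLt
    rcases Nat.even_or_odd' i.val with ⟨k, hk | hk⟩
    · refine hi (hmove i ⟨i.val - 1, by omega⟩ ?_ ?_ ?_) <;>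
        simp only [hadj, z, ne_eq, Fin.ext_iff] <;> omega
    · refine hi (hmove i ⟨i.val + 1, by omega⟩ ?_ ?_ ?_) <;>
        simp only [hadj, z, ne_eq, Fin.ext_iff, true_and] <;> omega
  have h2 := (card_le_card hsub).trans card_le_two
  have h3 := τ.support.card_add_card_compl
  rw [Fintype.card_fin] at h3
  omega

theorem stmt1 (n : ℕ) (hn : 4 ≤ n) (G : SimpleGraph (Fin n))
    (hq : qSpecRad G ≥
      if Odd n then ((n : ℝ) + 2 + Real.sqrt (((n : ℝ) - 2) ^ 2 + 8)) / 2
      else ((n : ℝ) + 1 + Real.sqrt (((n : ℝ) - 1) ^ 2 + 8)) / 2) :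
    HasChordedCycle G ∨ Nonempty (G ≃g Fgraph n ((n - 1) / 2)) := by
  classical
  by_contra! hcon
  obtain ⟨hG, hiso⟩ := hcon
  have hn4 : (4 : ℝ) ≤ n := by exact_mod_cast hn
  obtain ⟨k, hk, hqk⟩ : ∃ k : ℝ, ((Odd n ∧ k = n - 1) ∨ (Even n ∧ k = n)) ∧
      n + 2 / k < qSpecRad G := by
    split_ifs at hq with hodd
    · have hn5 : 5 ≤ n := by
        rcases hodd with ⟨m, hm⟩
        omega
      have hn5' : (5 : ℝ) ≤ n := by exact_mod_cast hn5
      refine ⟨n - 1, Or.inl ⟨hodd, rfl⟩, lt_of_lt_of_le ?_ hq⟩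
      have h1 : (0 : ℝ) < n - 1 := by linarith
      have : (n : ℝ) - 2 + 4 / (n - 1) < Real.sqrt (((n : ℝ) - 2) ^ 2 + 8) := by
        apply Real.lt_sqrt_of_sq_lt
        have : ((n : ℝ) - 2) ^ 2 + 8 - (n - 2 + 4 / (n - 1)) ^ 2 =
            8 * (n - 3) / (n - 1) ^ 2 := by
          field_simp
          ring
        have h2 : 0 < 8 * ((n : ℝ) - 3) / (n - 1) ^ 2 := by
          have : (0 : ℝ) < n - 3 := by linarith
          positivity
        linarith
      have h4 : 4 / ((n : ℝ) - 1) = 2 * (2 / (n - 1)) := by ring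
      linarith
    · refine ⟨n, Or.inr ⟨Nat.not_odd_iff_even.mp hodd, rfl⟩, lt_of_lt_of_le ?_ hq⟩
      have h1 : (0 : ℝ) < n := by linarith
      have : (n : ℝ) - 1 + 4 / n < Real.sqrt (((n : ℝ) - 1) ^ 2 + 8) := by
        apply Real.lt_sqrt_of_sq_lt
        have : ((n : ℝ) - 1) ^ 2 + 8 - (n - 1 + 4 / n) ^ 2 = 8 * (n - 2) / n ^ 2 := by
          field_simp
          ring
        have h2 : 0 < 8 * ((n : ℝ) - 2) / n ^ 2 := by
          have : (0 : ℝ) < n - 2 := by linarith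
          positivity
        linarith
      have h4 : 4 / (n : ℝ) = 2 * (2 / n) := by ring
      linarith
  have hkpos : 0 < k := by rcases hk with ⟨-, h⟩ | ⟨-, h⟩ <;> linarith
  have h2k : 0 < 2 / k := by positivity
  have hkq : 2 < (qSpecRad G - n) * k := by
    rw [← div_lt_iff₀ hkpos]
    linarith
  by_cases hdeg : ∀ v, G.degree v + 2 ≤ n
  · refine lt_irrefl _ (qSpecRad_lt_of_not_hasChordedCycle G hG (r := qSpecRad G) ?_ ?_ ?_)
    · simpa using hdeg
    · rw [Fintype.card_fin]
      linarith
    · rw [Fintype.card_fin]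
      rcases hk with ⟨-, h⟩ | ⟨-, h⟩ <;> subst h <;> nlinarith
  push Not at hdeg
  obtain ⟨u, hu⟩ := hdeg
  have hadj : ∀ v, v ≠ u → G.Adj u v := by
    have hsub : G.neighborFinset u ⊆ univ.erase u := by
      intro v hv
      rw [mem_neighborFinset] at hv
      simp [hv.ne']
    have heq := eq_of_subset_of_card_le hsub (by
      rw [card_neighborFinset_eq_degree, card_erase_of_mem (mem_univ u), card_univ,
        Fintype.card_fin]
      omega)
    intro v hv
    rw [← mem_neighborFinset, heq]
    simp [hv]
  obtain ⟨σ, hσ⟩ := exists_isFanOf hadj (by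
    intro v x y hv hx hy hvx hvy
    by_contra hxy
    exact hG (hasChordedCycle_of_four_cycle (hadj x hx) hvx.symm hvy (hadj y hy).symm
      (hadj v hv) hxy))
  obtain ⟨w, τ, hτ, hτn⟩ := exists_isFanOf_Fgraph n hn
  have hσ2 := Equiv.Perm.two_dvd_card_support hσ.pow_two
  have hτ2 := Equiv.Perm.two_dvd_card_support hτ.pow_two
  have hσlt := hσ.card_support_lt
  have hτlt := hτ.card_support_lt
  rw [Fintype.card_fin] at hσlt hτlt
  by_cases hs : n ≤ #σ.support + 2
  · exact hiso.false (hσ.nonempty_iso hτ (by omega)).some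
  refine lt_irrefl _ (hσ.qSpecRad_lt (r := qSpecRad G) (by simpa using hn) ?_ ?_)
  · rw [Fintype.card_fin]
    linarith
  · rw [Fintype.card_fin]
    rcases hk with ⟨-, h⟩ | ⟨he, h⟩
    · have : (#σ.support : ℝ) + 3 ≤ n := by exact_mod_cast (by omega : #σ.support + 3 ≤ n)
      rw [h] at hkq
      nlinarith
    · have : (#σ.support : ℝ) + 4 ≤ n := by
        have := he.two_dvd
        exact_mod_cast (by omega : #σ.support + 4 ≤ n)
      rw [h] at hkq
      nlinarith
end

section
/- For even n ≥ 6 and a = (n-4)/2, the graph H^{(n)}_{0,a,1,0} satisfies q(H^{(n)}_{0,a,1,0}) < n. -/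
open SimpleGraph Finset

open Classical in
theorem signlessLapMatrix_mulVec_apply {V : Type*} [Fintype V] [DecidableEq V]
    (G : SimpleGraph V) (x : V → ℝ) (i : V) :
    (signlessLapMatrix G).mulVec x i = ∑ j, if G.Adj i j then x i + x j else 0 := by
  have hdeg : (G.degree i : ℝ) = ∑ j, if G.Adj i j then (1 : ℝ) else 0 := by
    rw [← Finset.sum_filter, Finset.sum_const, nsmul_eq_mul, mul_one,
      ← SimpleGraph.card_neighborFinset_eq_degree, SimpleGraph.neighborFinset_eq_filter]
  have hadj : (signlessLapMatrix G).mulVec x i =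
      (G.degree i : ℝ) * x i + ∑ j, if G.Adj i j then x j else 0 := by
    simp only [signlessLapMatrix, Matrix.add_mulVec, Pi.add_apply, Matrix.mulVec_diagonal]
    congr 1
    simp only [Matrix.mulVec, dotProduct, SimpleGraph.adjMatrix_apply, ite_mul, one_mul,
      zero_mul]
  rw [hadj, hdeg, Finset.sum_mul, ← Finset.sum_add_distrib]
  refine Finset.sum_congr rfl fun j _ => ?_
  split_ifs <;> ring

/-- A Collatz–Wielandt bound: a positive vector `x` with `Q x < c x` forces `q < c`. -/
theorem qSpecRad_lt_of_mulVec_lt {V : Type*} [Fintype V] [DecidableEq V]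
    (G : SimpleGraph V) (c : ℝ) (hc : 0 < c) (x : V → ℝ) (hx : ∀ i, 0 < x i)
    (h : ∀ i, (signlessLapMatrix G).mulVec x i < c * x i) : qSpecRad G < c := by
  classical
  have key : ∀ r ∈ spectrum ℝ (signlessLapMatrix G), r < c := by
    intro r hr
    rw [← Matrix.spectrum_toLin', ← Module.End.hasEigenvalue_iff_mem_spectrum] at hr
    obtain ⟨y, hy⟩ := hr.exists_hasEigenvector
    have hmul : (signlessLapMatrix G).mulVec y = r • y := by
      simpa using hy.apply_eq_smul
    obtain ⟨k, hk⟩ := Function.ne_iff.mp hy.2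
    obtain ⟨i, -, hi⟩ := Finset.exists_max_image Finset.univ (fun j => |y j| / x j)
      ⟨k, Finset.mem_univ k⟩
    set t := |y i| / x i with ht
    have hle : ∀ j, |y j| ≤ t * x j := fun j =>
      (div_le_iff₀ (hx j)).mp (hi j (Finset.mem_univ j))
    have htpos : 0 < t :=
      (div_pos (abs_pos.mpr hk) (hx k)).trans_le (hi k (Finset.mem_univ k))
    have hyi : |y i| = t * x i := by rw [ht, div_mul_cancel₀ _ (hx i).ne']
    have hri : r * y i = ∑ j, if G.Adj i j then y i + y j else 0 := by
      rw [← signlessLapMatrix_mulVec_apply, hmul]; rfl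
    have habs : |r| * |y i| ≤ t * (signlessLapMatrix G).mulVec x i := by
      rw [← abs_mul, hri, signlessLapMatrix_mulVec_apply, Finset.mul_sum]
      refine (Finset.abs_sum_le_sum_abs _ _).trans (Finset.sum_le_sum fun j _ => ?_)
      split_ifs
      · linarith [abs_add_le (y i) (y j), hle i, hle j]
      · simp
    have hlt : |r| * (t * x i) < c * (t * x i) := by
      rw [← hyi]
      refine habs.trans_lt ?_
      rw [hyi]
      nlinarith [mul_lt_mul_of_pos_left (h i) htpos]
    exact (le_abs_self r).trans_lt (lt_of_mul_lt_mul_right hlt (mul_pos htpos (hx i)).le)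
  rcases (spectrum ℝ (signlessLapMatrix G)).eq_empty_or_nonempty with he | hne
  · rw [qSpecRad, he, Real.sSup_empty]; exact hc
  · exact key _ (hne.csSup_mem (Matrix.finite_real_spectrum))

/-- Positive vertex weights witnessing `Q x < n x` for `H^{(n)}_{0,(n-4)/2,1,0}`. -/
noncomputable def hgraphWeight (n : ℕ) (i : Fin n) : ℝ :=
  if i.val = 0 then 12 * ((n : ℝ) - 3) else if i.val = 1 then 20 else
    if i.val = 2 then 16 else if i.val = n - 1 then 6 else 15

theorem hgraphWeight_pos {n : ℕ} (hn : 6 ≤ n) (i : Fin n) : 0 < hgraphWeight n i := by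
  have : (6 : ℝ) ≤ n := by exact_mod_cast hn
  unfold hgraphWeight
  split_ifs <;> linarith

/-- The edges of `H^{(n)}_{0,a,1,0}` with `n = 2a + 4`. -/
theorem hgraph_adj_iff {a n : ℕ} (hna : n = 2 * a + 4) (i j : Fin n) :
    (Hgraph n 0 a 1 0).Adj i j ↔
      (i.val = 0 ∧ j.val ≠ 0 ∧ j.val ≠ n - 1) ∨ (j.val = 0 ∧ i.val ≠ 0 ∧ i.val ≠ n - 1) ∨
      (i.val = 1 ∧ (j.val = 2 ∨ j.val = n - 1)) ∨ (j.val = 1 ∧ (i.val = 2 ∨ i.val = n - 1)) ∨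
      (3 ≤ i.val ∧ i.val % 2 = 1 ∧ j.val = i.val + 1 ∧ i.val + 1 < n - 1) ∨
      (3 ≤ j.val ∧ j.val % 2 = 1 ∧ i.val = j.val + 1 ∧ j.val + 1 < n - 1) := by
  obtain ⟨i, hi⟩ := i
  obtain ⟨j, hj⟩ := j
  simp only [Hgraph, SimpleGraph.fromRel_adj, ne_eq, Fin.mk.injEq]
  constructor
  · rintro ⟨h0, (h | h | h | h | h | h | h) | (h | h | h | h | h | h | h)⟩ <;> omega
  · rintro (h | h | h | h | h | h)
    · refine ⟨by omega, Or.inl ?_⟩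
      omega
    · refine ⟨by omega, Or.inr ?_⟩
      omega
    · refine ⟨by omega, Or.inl ?_⟩
      omega
    · refine ⟨by omega, Or.inr ?_⟩
      omega
    · exact ⟨by omega, Or.inl <| Or.inr <| Or.inr <| Or.inr <| Or.inr <| Or.inl <| by omega⟩
    · exact ⟨by omega, Or.inr <| Or.inr <| Or.inr <| Or.inr <| Or.inr <| Or.inl <| by omega⟩

theorem hgraph_mulVec_lt {a n : ℕ} (hn : 6 ≤ n) (hna : n = 2 * a + 4) (i : Fin n) :
    (signlessLapMatrix (Hgraph n 0 a 1 0)).mulVec (hgraphWeight n) i <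
      n * hgraphWeight n i := by
  classical
  have hnR : (6 : ℝ) ≤ n := by exact_mod_cast hn
  have hilt := i.isLt
  have hsum : ∀ S : Finset (Fin n), (∀ j, (Hgraph n 0 a 1 0).Adj i j ↔ j ∈ S) →
      (signlessLapMatrix (Hgraph n 0 a 1 0)).mulVec (hgraphWeight n) i =
        ∑ j ∈ S, (hgraphWeight n i + hgraphWeight n j) := by
    intro S hS
    rw [signlessLapMatrix_mulVec_apply]
    simp [hS]
  have hadj := hgraph_adj_iff hna i
  obtain ⟨v0, hv0⟩ : ∃ v : Fin n, v.val = 0 := ⟨⟨0, by omega⟩, rfl⟩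
  obtain ⟨v1, hv1⟩ : ∃ v : Fin n, v.val = 1 := ⟨⟨1, by omega⟩, rfl⟩
  obtain ⟨v2, hv2⟩ : ∃ v : Fin n, v.val = 2 := ⟨⟨2, by omega⟩, rfl⟩
  obtain ⟨p, hp⟩ : ∃ v : Fin n, v.val = n - 1 := ⟨⟨n - 1, by omega⟩, rfl⟩
  have w0 : hgraphWeight n v0 = 12 * ((n : ℝ) - 3) := by simp [hgraphWeight, hv0]
  have w1 : hgraphWeight n v1 = 20 := by simp [hgraphWeight, hv1]
  have w2 : hgraphWeight n v2 = 16 := by simp [hgraphWeight, hv2]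
  have wp : hgraphWeight n p = 6 := by
    simp only [hgraphWeight]
    rw [if_neg (by omega), if_neg (by omega), if_neg (by omega), if_pos hp]
  have wr : ∀ j : Fin n, 3 ≤ j.val → j.val ≠ n - 1 → hgraphWeight n j = 15 := by
    intro j h3 hne
    simp only [hgraphWeight]
    rw [if_neg (by omega), if_neg (by omega), if_neg (by omega), if_neg hne]
  rcases (by omega : i.val = 0 ∨ i.val = 1 ∨ i.val = 2 ∨ i.val = n - 1 ∨
    (3 ≤ i.val ∧ i.val ≠ n - 1 ∧ i.val % 2 = 1) ∨
    (3 ≤ i.val ∧ i.val ≠ n - 1 ∧ i.val % 2 = 0)) with h | h | h | h | ⟨h3, hne, ho⟩ | ⟨h3, hne, ho⟩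
  · obtain rfl : v0 = i := Fin.ext (by omega)
    rw [signlessLapMatrix_mulVec_apply, w0]
    have hterm : ∀ j : Fin n, (if (Hgraph n 0 a 1 0).Adj v0 j
        then 12 * ((n : ℝ) - 3) + hgraphWeight n j else 0) =
        (12 * ((n : ℝ) - 3) + 15) + (if j = v1 then 5 else 0) + (if j = v2 then 1 else 0)
          - (if j = v0 then 12 * ((n : ℝ) - 3) + 15 else 0)
          - (if j = p then 12 * ((n : ℝ) - 3) + 15 else 0) := by
      intro j
      have hjlt := j.isLt
      have hadj_j : (Hgraph n 0 a 1 0).Adj v0 j ↔ j ≠ v0 ∧ j ≠ p := by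
        simp only [hadj, ne_eq, Fin.ext_iff]
        omega
      have h01 : v0 ≠ v1 := by rw [ne_eq, Fin.ext_iff]; omega
      have h02 : v0 ≠ v2 := by rw [ne_eq, Fin.ext_iff]; omega
      have h0p : v0 ≠ p := by rw [ne_eq, Fin.ext_iff]; omega
      have h12 : v1 ≠ v2 := by rw [ne_eq, Fin.ext_iff]; omega
      have h1p : v1 ≠ p := by rw [ne_eq, Fin.ext_iff]; omega
      have h2p : v2 ≠ p := by rw [ne_eq, Fin.ext_iff]; omega
      simp only [hadj_j]
      by_cases e0 : j = v0
      · subst e0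
        simp [h01, h02, h0p]
      by_cases e1 : j = v1
      · subst e1
        simp only [ne_eq, h01.symm, h12, h1p, not_false_eq_true, and_self, if_true, if_false, w1]
        ring
      by_cases e2 : j = v2
      · subst e2
        simp only [ne_eq, h02.symm, h12.symm, h2p, not_false_eq_true, and_self, if_true,
          if_false, w2]
        ring
      by_cases ep : j = p
      · subst ep
        simp [h0p.symm, h1p.symm, h2p.symm]
      have wj : hgraphWeight n j = 15 := by
        rw [Fin.ext_iff] at e0 e1 e2 ep
        exact wr j (by omega) (by omega)
      simp [e0, e1, e2, ep, wj]
    simp only [hterm, Finset.sum_sub_distrib, Finset.sum_add_distrib, Finset.sum_ite_eq',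
      Finset.mem_univ, if_true, Finset.sum_const, Finset.card_univ, Fintype.card_fin,
      nsmul_eq_mul]
    nlinarith
  · obtain rfl : v1 = i := Fin.ext (by omega)
    rw [hsum {v0, v2, p} (fun j => by
      have := j.isLt
      simp only [hadj, Finset.mem_insert, Finset.mem_singleton, Fin.ext_iff]
      omega), Finset.sum_insert, Finset.sum_pair, w0, w1, w2, wp]
    · linarith
    · simp only [ne_eq, Fin.ext_iff]; omega
    · simp only [Finset.mem_insert, Finset.mem_singleton, Fin.ext_iff]; omega
  · obtain rfl : v2 = i := Fin.ext (by omega)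
    rw [hsum {v0, v1} (fun j => by
      have := j.isLt
      simp only [hadj, Finset.mem_insert, Finset.mem_singleton, Fin.ext_iff]
      omega), Finset.sum_pair, w0, w1, w2]
    · linarith
    · simp only [ne_eq, Fin.ext_iff]; omega
  · obtain rfl : p = i := Fin.ext (by omega)
    rw [hsum {v1} (fun j => by
      have := j.isLt
      simp only [hadj, Finset.mem_singleton, Fin.ext_iff]
      omega), Finset.sum_singleton, w1, wp]
    linarith
  · obtain ⟨k, hk⟩ : ∃ k : Fin n, k.val = i.val + 1 := ⟨⟨i.val + 1, by omega⟩, rfl⟩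
    rw [hsum {v0, k} (fun j => by
      have := j.isLt
      simp only [hadj, Finset.mem_insert, Finset.mem_singleton, Fin.ext_iff]
      omega), Finset.sum_pair, w0, wr i h3 hne, wr k (by omega) (by omega)]
    · linarith
    · simp only [ne_eq, Fin.ext_iff]; omega
  · obtain ⟨k, hk⟩ : ∃ k : Fin n, k.val = i.val - 1 := ⟨⟨i.val - 1, by omega⟩, rfl⟩
    rw [hsum {v0, k} (fun j => by
      have := j.isLt
      simp only [hadj, Finset.mem_insert, Finset.mem_singleton, Fin.ext_iff]
      omega), Finset.sum_pair, w0, wr i h3 hne, wr k (by omega) (by omega)]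
    · linarith
    · simp only [ne_eq, Fin.ext_iff]; omega

theorem stmt3 (n a : ℕ) (hn : 6 ≤ n) (he : Even n) (ha : a = (n - 4) / 2) :
    qSpecRad (Hgraph n 0 a 1 0) < n := by
  have hna : n = 2 * a + 4 := by
    obtain ⟨k, hk⟩ := he
    omega
  exact qSpecRad_lt_of_mulVec_lt _ _ (by exact_mod_cast (by omega : 0 < n)) _ (hgraphWeight_pos hn)
    (hgraph_mulVec_lt hn hna)
end

section
/- For every integer n ≥ 5 and all nonnegative integers a₁, a₂, b₁, b₂ with a₁ + a₂ ≥ 1, b₁ + b₂ ≥ 1 and n = 3 + a₁ + 2a₂ + b₁ + 2b₂, the graph G = H^{(n)}_{a₁,a₂,b₁,b₂} satisfies q(G) < n. -/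
open SimpleGraph Finset

/-- Collatz–Wielandt bound: if a nonnegative matrix satisfies `M x < c x` entrywise for some
positive vector `x`, then every real eigenvalue of `M` is less than `c`. -/
theorem lt_of_mem_spectrum_of_mulVec_lt {V : Type*} [Fintype V] [DecidableEq V]
    {M : Matrix V V ℝ} (hM : ∀ i j, 0 ≤ M i j) {x : V → ℝ} (hx : ∀ i, 0 < x i) {c : ℝ}
    (h : ∀ i, ∑ j, M i j * x j < c * x i) {r : ℝ} (hr : r ∈ spectrum ℝ M) : r < c := by
  rw [← Matrix.spectrum_toLin', ← Module.End.hasEigenvalue_iff_mem_spectrum] at hr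
  obtain ⟨y, hy⟩ := hr.exists_hasEigenvector
  have hMy : ∀ i, ∑ j, M i j * y j = r * y i := fun i => by
    have := congrFun hy.apply_eq_smul i
    simpa [Matrix.toLin'_apply, Matrix.mulVec, dotProduct] using this
  obtain ⟨k, hk⟩ : ∃ k, y k ≠ 0 := Function.ne_iff.mp hy.2
  obtain ⟨i, -, hi⟩ := Finset.exists_max_image Finset.univ (fun j => |y j| / x j) ⟨k, mem_univ k⟩
  set t := |y i| / x i with ht
  have hle : ∀ j, |y j| ≤ t * x j := fun j => (div_le_iff₀ (hx j)).mp (hi j (mem_univ j))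
  have htpos : 0 < t := (div_pos (abs_pos.mpr hk) (hx k)).trans_le (hi k (mem_univ k))
  have hyi : |y i| = t * x i := by rw [ht, div_mul_cancel₀ _ (hx i).ne']
  have hyi_pos : 0 < |y i| := hyi ▸ mul_pos htpos (hx i)
  have : r * |y i| < c * |y i| := calc
    r * |y i| ≤ |r * y i| := by
      rw [abs_mul]; exact mul_le_mul_of_nonneg_right (le_abs_self r) (abs_nonneg _)
    _ = |∑ j, M i j * y j| := by rw [hMy]
    _ ≤ ∑ j, |M i j * y j| := Finset.abs_sum_le_sum_abs _ _
    _ ≤ ∑ j, t * (M i j * x j) := Finset.sum_le_sum fun j _ => by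
      rw [abs_mul, abs_of_nonneg (hM i j), mul_left_comm]
      exact mul_le_mul_of_nonneg_left (hle j) (hM i j)
    _ = t * ∑ j, M i j * x j := by rw [Finset.mul_sum]
    _ < t * (c * x i) := mul_lt_mul_of_pos_left (h i) htpos
    _ = c * |y i| := by rw [hyi]; ring
  exact lt_of_mul_lt_mul_right this hyi_pos.le

open Classical in
theorem signlessLapMatrix_nonneg {V : Type*} [Fintype V] [DecidableEq V]
    (G : SimpleGraph V) (i j : V) : 0 ≤ signlessLapMatrix G i j := by
  simp only [signlessLapMatrix, Matrix.add_apply, Matrix.diagonal_apply, adjMatrix_apply]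
  split_ifs <;> positivity

open Classical in
theorem sum_signlessLapMatrix_mul {V : Type*} [Fintype V] [DecidableEq V]
    (G : SimpleGraph V) (x : V → ℝ) (i : V) :
    ∑ j, signlessLapMatrix G i j * x j = ∑ j with G.Adj i j, (x i + x j) := by
  have hdeg : (G.degree i : ℝ) = ∑ j with G.Adj i j, (1 : ℝ) := by
    rw [← card_neighborFinset_eq_degree, neighborFinset_eq_filter]; simp
  simp only [signlessLapMatrix, Matrix.add_apply, Matrix.diagonal_apply, adjMatrix_apply,
    add_mul, Finset.sum_add_distrib, ite_mul, zero_mul, one_mul, Finset.sum_filter]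
  rw [Finset.sum_ite_eq, if_pos (mem_univ i)]
  congr 1
  · rw [← Finset.sum_filter, Finset.sum_const, nsmul_eq_mul, hdeg]
    simp

/-- A positive vector `x` with `Q(G) x < c x` entrywise witnesses `q(G) < c`. -/
theorem qSpecRad_lt_of_sum_lt {V : Type*} [Fintype V] [DecidableEq V]
    (G : SimpleGraph V) {x : V → ℝ} (hx : ∀ i, 0 < x i) {c : ℝ} (hc : 0 < c)
    (h : ∀ i, ∑ j, signlessLapMatrix G i j * x j < c * x i) : qSpecRad G < c := by
  rcases (spectrum ℝ (signlessLapMatrix G)).eq_empty_or_nonempty with he | hne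
  · simpa [qSpecRad, he] using hc
  · exact lt_of_mem_spectrum_of_mulVec_lt (signlessLapMatrix_nonneg G) hx h
      (hne.csSup_mem (Matrix.finite_real_spectrum))

/-- Weights `α, β, w, p, s` for `u`, `v`, `w` and the vertices attached at `u` and at `v`,
where `A` and `B` are the numbers of the latter. -/
theorem exists_weights (A B : ℕ) (hA : 1 ≤ A) (hB : 1 ≤ B) :
    ∃ α β w p s : ℝ, 0 < α ∧ 0 < β ∧ 0 < w ∧ 0 < p ∧ 0 < s ∧
      β + w + A * p < (1 + B) * α ∧ α + w + B * s < (1 + A) * β ∧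
      α + β < (A + B + 1) * w ∧ α < (A + B + 2) * p ∧ β < (A + B + 2) * s ∧
      (2 < A + B → α < (A + B) * p ∧ β < (A + B) * s) := by
  rcases (show A + B = 2 ∨ 3 ≤ A + B by omega) with h2 | h3
  · obtain rfl : A = 1 := by omega
    obtain rfl : B = 1 := by omega
    exact ⟨1, 1, 0.7, 0.27, 0.27, by norm_num⟩
  have hA' : (1 : ℝ) ≤ A := by exact_mod_cast hA
  have hB' : (1 : ℝ) ≤ B := by exact_mod_cast hB
  have h3' : (3 : ℝ) ≤ A + B := by exact_mod_cast h3
  generalize (A : ℝ) = a at *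
  generalize (B : ℝ) = b at *
  obtain ⟨m, hm⟩ : ∃ m, m = a + b := ⟨_, rfl⟩
  rw [← hm] at h3' ⊢
  have hm0 : 0 < m := by linarith
  obtain ⟨k, hk⟩ : ∃ k, k = (m + 1) ^ 2 / m := ⟨_, rfl⟩
  have hkm : k * m = (m + 1) ^ 2 := by rw [hk]; field_simp
  have hk2 : m + 2 < k := by rw [hk, lt_div_iff₀ hm0]; nlinarith
  have hab : m - 1 ≤ a * b := by nlinarith
  have hprod : (m + 2) ^ 2 < (a * k - 1) * (b * k - 1) := by
    have h1 : (m - 1) * k ^ 2 ≤ a * b * k ^ 2 := by gcongr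
    have h4 : (m - 1) * (m + 2) ^ 2 ≤ (m - 1) * k ^ 2 := by
      have : 0 ≤ m - 1 := by linarith
      gcongr
    have : (a * k - 1) * (b * k - 1) = a * b * k ^ 2 - k * m + 1 := by rw [hm]; ring
    rw [this, hkm]
    nlinarith
  have hak : 0 < a * k - 1 := by nlinarith
  have hbk : 0 < b * k - 1 := by nlinarith
  obtain ⟨α, hα⟩ : ∃ α, α = (m + 2) + (a * k - 1) := ⟨_, rfl⟩
  obtain ⟨β, hβ⟩ : ∃ β, β = (m + 2) + (b * k - 1) := ⟨_, rfl⟩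
  have hα0 : 0 < α := by linarith
  have hβ0 : 0 < β := by linarith
  have e1 : β * (m + 2) < α * (b * k - 1) := by rw [hα, hβ]; nlinarith
  have e2 : α * (m + 2) < β * (a * k - 1) := by rw [hα, hβ]; nlinarith
  have f1 : β + (α + β) / (m + 1) + a * (α / m) < (1 + b) * α := by
    have : (1 + b) * α - (β + (α + β) / (m + 1) + a * (α / m)) =
        (α * (b * k - 1) - β * (m + 2)) / (m + 1) := by
      rw [hk, show a = m - b by linarith]; field_simp; ring
    have : 0 < (α * (b * k - 1) - β * (m + 2)) / (m + 1) := by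
      apply div_pos <;> linarith
    linarith
  have f2 : α + (α + β) / (m + 1) + b * (β / m) < (1 + a) * β := by
    have : (1 + a) * β - (α + (α + β) / (m + 1) + b * (β / m)) =
        (β * (a * k - 1) - α * (m + 2)) / (m + 1) := by
      rw [hk, show b = m - a by linarith]; field_simp; ring
    have : 0 < (β * (a * k - 1) - α * (m + 2)) / (m + 1) := by
      apply div_pos <;> linarith
    linarith
  obtain ⟨δ, hδ0, hδ⟩ := exists_between (lt_min (sub_pos.mpr f1) (sub_pos.mpr f2))
  obtain ⟨hδ1, hδ2⟩ := lt_min_iff.mp hδ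
  obtain ⟨ε, hε⟩ : ∃ ε, ε = δ / (m + 1) := ⟨_, rfl⟩
  have hε0 : 0 < ε := by rw [hε]; positivity
  have hεm : ε * (m + 1) = δ := by rw [hε]; field_simp
  have gα : m * (α / m + ε) = α + m * ε := by field_simp
  have gβ : m * (β / m + ε) = β + m * ε := by field_simp
  have gw : (m + 1) * ((α + β) / (m + 1) + ε) = α + β + (m + 1) * ε := by field_simp
  have hmε : 0 < m * ε := by positivity
  have haε : a * ε ≤ m * ε := by gcongr; linarith
  have hbε : b * ε ≤ m * ε := by gcongr; linarith
  have hp : 0 < α / m + ε := by positivity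
  have hs : 0 < β / m + ε := by positivity
  refine ⟨α, β, (α + β) / (m + 1) + ε, α / m + ε, β / m + ε, hα0, hβ0, by positivity, hp, hs,
    ?_, ?_, ?_, ?_, ?_, fun _ => ⟨?_, ?_⟩⟩
  · linarith
  · linarith
  · linarith
  · linarith
  · linarith
  · linarith
  · linarith

open Classical in
/-- The weights at the neighbours of `i` are bounded by the sum over any set of naturals
containing the neighbours. -/
theorem sum_adj_le_sum {n : ℕ} (G : SimpleGraph (Fin n)) {f : ℕ → ℝ} (hf : ∀ k, 0 < f k)
    (i : Fin n) (S : Finset ℕ) (hS : ∀ j, G.Adj i j → j.val ∈ S) :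
    ∑ j with G.Adj i j, (f i + f j) ≤ ∑ k ∈ S, (f i + f k) := by
  calc ∑ j with G.Adj i j, (f i + f j)
      = ∑ k ∈ ({j | G.Adj i j} : Finset (Fin n)).map Fin.valEmbedding, (f i + f k) := by
        rw [Finset.sum_map]; rfl
    _ ≤ ∑ k ∈ S, (f i + f k) := by
        refine Finset.sum_le_sum_of_subset_of_nonneg ?_ fun k _ _ => (add_pos (hf _) (hf _)).le
        intro k hk
        obtain ⟨j, hj, rfl⟩ := Finset.mem_map.mp hk
        exact hS j (Finset.mem_filter.mp hj).2

set_option maxHeartbeats 2000000 in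
theorem stmt4 (n a₁ a₂ b₁ b₂ : ℕ) (hn : 5 ≤ n) (ha : 1 ≤ a₁ + a₂) (hb : 1 ≤ b₁ + b₂)
    (hsum : n = 3 + a₁ + 2 * a₂ + b₁ + 2 * b₂) :
    qSpecRad (Hgraph n a₁ a₂ b₁ b₂) < n := by
  classical
  obtain ⟨A, hA⟩ : ∃ A, A = a₁ + 2 * a₂ := ⟨_, rfl⟩
  obtain ⟨B, hB⟩ : ∃ B, B = b₁ + 2 * b₂ := ⟨_, rfl⟩
  have hnAB : (n : ℝ) = 3 + A + B := by
    rw [show n = 3 + A + B by omega]; push_cast; ring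
  obtain ⟨α, β, w, p, s, hα, hβ, hw, hp, hs, h0, h1, h2, h3, h4, h5⟩ :=
    exists_weights A B (by omega) (by omega)
  obtain ⟨f, hf⟩ : ∃ f : ℕ → ℝ, f = fun k => if k = 0 then α else if k = 1 then β else
    if k = 2 then w else if k < 3 + A then p else s := ⟨_, rfl⟩
  have f0 : f 0 = α := by simp [hf]
  have f1 : f 1 = β := by simp [hf]
  have f2 : f 2 = w := by simp [hf]
  have fp : ∀ k, 3 ≤ k → k < 3 + A → f k = p := fun k hk hk' => by
    simp [hf, hk', show k ≠ 0 by omega, show k ≠ 1 by omega, show k ≠ 2 by omega]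
  have fs : ∀ k, 3 + A ≤ k → f k = s := fun k hk => by
    simp [hf, show ¬ k < 3 + A by omega, show k ≠ 0 by omega, show k ≠ 1 by omega,
      show k ≠ 2 by omega]
  have fpos : ∀ k, 0 < f k := fun k => by
    simp only [hf]; split_ifs <;> assumption
  refine qSpecRad_lt_of_sum_lt _ (x := fun i : Fin n => f i) (fun i => fpos i)
    (by exact_mod_cast (by omega : 0 < n)) fun i => ?_
  rw [sum_signlessLapMatrix_mul]
  have key := sum_adj_le_sum (Hgraph n a₁ a₂ b₁ b₂) fpos i
  simp only [Hgraph, fromRel_adj, ne_eq, Fin.ext_iff] at key ⊢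
  have hi := i.isLt
  rcases (show i.val = 0 ∨ i.val = 1 ∨ i.val = 2 ∨ (3 ≤ i.val ∧ i.val < 3 + a₁) ∨
      (3 + a₁ ≤ i.val ∧ i.val < 3 + A) ∨ (3 + A ≤ i.val ∧ i.val < 3 + A + b₁) ∨
      (3 + A + b₁ ≤ i.val ∧ i.val < 3 + A + B) by omega) with h | h | h | h | h | h | h
  · refine (key (insert 1 (insert 2 (Finset.Ico 3 (3 + A)))) fun j hj => ?_).trans_lt ?_
    · simp only [Finset.mem_insert, Finset.mem_Ico]; omega
    · rw [Finset.sum_insert (by simp), Finset.sum_insert (by simp), h, f0, f1, f2,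
        Finset.sum_congr rfl (g := fun _ => α + p) fun k hk => by
          rw [fp k (Finset.mem_Ico.mp hk).1 (Finset.mem_Ico.mp hk).2]]
      simp only [Finset.sum_const, Nat.card_Ico, nsmul_eq_mul, Nat.add_sub_cancel_left]
      rw [hnAB]; linarith
  · refine (key (insert 0 (insert 2 (Finset.Ico (3 + A) (3 + A + B)))) fun j hj => ?_).trans_lt ?_
    · simp only [Finset.mem_insert, Finset.mem_Ico]; omega
    · rw [Finset.sum_insert (by simp), Finset.sum_insert (by simp; omega), h, f0, f1, f2,
        Finset.sum_congr rfl (g := fun _ => β + s) fun k hk => by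
          rw [fs k (Finset.mem_Ico.mp hk).1]]
      simp only [Finset.sum_const, Nat.card_Ico, nsmul_eq_mul, Nat.add_sub_cancel_left]
      rw [hnAB]; linarith
  · refine (key {0, 1} fun j hj => ?_).trans_lt ?_
    · simp only [Finset.mem_insert, Finset.mem_singleton]; omega
    · rw [Finset.sum_pair (by simp), h, f0, f1, f2, hnAB]; linarith
  · refine (key {0} fun j hj => ?_).trans_lt ?_
    · simp only [Finset.mem_singleton]; omega
    · rw [Finset.sum_singleton, f0, fp i (by omega) (by omega), hnAB]; linarith
  · have h6 := (h5 (by omega)).1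
    obtain ⟨k, hk, hk'⟩ : ∃ k, (3 ≤ k ∧ k < 3 + A) ∧
        (((i.val - (3 + a₁)) % 2 = 0 ∧ k = i.val + 1) ∨
          ((i.val - (3 + a₁)) % 2 = 1 ∧ k + 1 = i.val)) := by
      rcases Nat.mod_two_eq_zero_or_one (i.val - (3 + a₁)) with e | e
      · exact ⟨i.val + 1, by omega, by omega⟩
      · exact ⟨i.val - 1, by omega, by omega⟩
    refine (key {0, k} fun j hj => ?_).trans_lt ?_
    · simp only [Finset.mem_insert, Finset.mem_singleton]; omega
    · rw [Finset.sum_pair (by omega), f0, fp i (by omega) (by omega), fp k hk.1 hk.2, hnAB]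
      linarith
  · refine (key {1} fun j hj => ?_).trans_lt ?_
    · simp only [Finset.mem_singleton]; omega
    · rw [Finset.sum_singleton, f1, fs i (by omega), hnAB]; linarith
  · have h6 := (h5 (by omega)).2
    obtain ⟨k, hk, hk'⟩ : ∃ k, 3 + A ≤ k ∧
        (((i.val - (3 + A + b₁)) % 2 = 0 ∧ k = i.val + 1) ∨
          ((i.val - (3 + A + b₁)) % 2 = 1 ∧ k + 1 = i.val)) := by
      rcases Nat.mod_two_eq_zero_or_one (i.val - (3 + A + b₁)) with e | e
      · exact ⟨i.val + 1, by omega, by omega⟩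
      · exact ⟨i.val - 1, by omega, by omega⟩
    refine (key {1, k} fun j hj => ?_).trans_lt ?_
    · simp only [Finset.mem_insert, Finset.mem_singleton]; omega
    · rw [Finset.sum_pair (by omega), f1, fs i (by omega), fs k hk, hnAB]
      linarith
end

section
/- For any simple graph G with at least one edge, q(G) ≤ max{ d(u) + d(v) : uv ∈ E(G) }, where d denotes vertex degree. Moreover, if G is connected, then equality holds if and only if G is regular or G is a semi-regular bipartite graph. -/
open SimpleGraph Finset

section SignlessLaplacian

variable {V : Type*} [Fintype V]

theorem isRegularGraph_iff (G : SimpleGraph V) [DecidableRel G.Adj] :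
    IsRegularGraph G ↔ ∃ d, ∀ v, G.degree v = d := by
  unfold IsRegularGraph SimpleGraph.IsRegularOfDegree
  simp only [← SimpleGraph.card_neighborSet_eq_degree, ← Nat.card_eq_fintype_card]

theorem isSemiregularBipartite_iff (G : SimpleGraph V) [DecidableRel G.Adj] :
    IsSemiregularBipartite G ↔ ∃ (s : Set V) (d₁ d₂ : ℕ),
      (∀ ⦃a b⦄, G.Adj a b → (a ∈ s ↔ b ∉ s)) ∧
      (∀ a ∈ s, G.degree a = d₁) ∧ (∀ a ∉ s, G.degree a = d₂) := by
  unfold IsSemiregularBipartite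
  simp only [← SimpleGraph.card_neighborSet_eq_degree, ← Nat.card_eq_fintype_card]

/-- In a connected graph the degree sum is constant along edges exactly when the graph is
regular or semi-regular bipartite. -/
theorem exists_degree_add_degree_eq_iff (G : SimpleGraph V) [DecidableRel G.Adj]
    (hG : G.Connected) :
    (∃ M : ℕ, ∀ u v, G.Adj u v → G.degree u + G.degree v = M) ↔
      IsRegularGraph G ∨ IsSemiregularBipartite G := by
  rw [isRegularGraph_iff, isSemiregularBipartite_iff]
  constructor
  · rintro ⟨M, hM⟩
    obtain ⟨r⟩ := hG.nonempty
    have key : ∀ v, G.degree v = G.degree r ∨ G.degree v + G.degree r = M := by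
      intro v
      refine Relation.ReflTransGen.head_induction_on
        ((G.reachable_iff_reflTransGen v r).1 (hG.preconnected v r)) (Or.inl rfl) ?_
      intro a b hab _ ih
      have := hM a b hab
      omega
    by_cases h : 2 * G.degree r = M
    · exact Or.inl ⟨G.degree r, fun v => by have := key v; omega⟩
    · refine Or.inr ⟨{v | G.degree v = G.degree r}, G.degree r, M - G.degree r, ?_, ?_, ?_⟩
      · intro a b hab
        have := hM a b hab
        have := key a
        have := key b
        simp only [Set.mem_ofPred_eq]
        omega
      · exact fun a ha => ha
      · intro a ha
        have := key a
        simp only [Set.mem_ofPred_eq] at ha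
        omega
  · rintro (⟨d, hd⟩ | ⟨s, d₁, d₂, hs, h₁, h₂⟩)
    · exact ⟨d + d, fun u v _ => by rw [hd, hd]⟩
    · refine ⟨d₁ + d₂, fun u v huv => ?_⟩
      by_cases hu : u ∈ s
      · rw [h₁ u hu, h₂ v ((hs huv).1 hu)]
      · have hv : v ∈ s := by
          by_contra hv
          exact hu ((hs huv).2 hv)
        rw [h₂ u hu, h₁ v hv, add_comm]

theorem mul_abs_add_le_sum (G : SimpleGraph V) [DecidableRel G.Adj] {μ : ℝ} {x : V → ℝ}
    (h : ∀ v, ∑ w ∈ G.neighborFinset v, (x v + x w) = μ * x v) (u v : V) :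
    μ * |x u + x v| ≤
      ∑ w ∈ G.neighborFinset u, |x u + x w| + ∑ w ∈ G.neighborFinset v, |x v + x w| := by
  calc μ * |x u + x v| ≤ |μ| * |x u + x v| :=
        mul_le_mul_of_nonneg_right (le_abs_self μ) (abs_nonneg _)
    _ = |∑ w ∈ G.neighborFinset u, (x u + x w) + ∑ w ∈ G.neighborFinset v, (x v + x w)| := by
        rw [h, h, ← mul_add, abs_mul]
    _ ≤ _ := (abs_add_le _ _).trans
        (add_le_add (Finset.abs_sum_le_sum_abs _ _) (Finset.abs_sum_le_sum_abs _ _))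

theorem sum_abs_add_le (G : SimpleGraph V) [DecidableRel G.Adj] {x : V → ℝ} {Y : ℝ}
    (hY : ∀ u v, G.Adj u v → |x u + x v| ≤ Y) (v : V) :
    ∑ w ∈ G.neighborFinset v, |x v + x w| ≤ G.degree v * Y := by
  rw [← SimpleGraph.card_neighborFinset_eq_degree, ← nsmul_eq_mul]
  exact Finset.sum_le_card_nsmul _ _ _ fun w hw => hY v w ((G.mem_neighborFinset v w).1 hw)

/-- An eigenvector for a positive eigenvalue has an edge on which the absolute value of the sum
of its entries is maximal and positive. -/
theorem exists_adj_abs_add_max (G : SimpleGraph V) [DecidableRel G.Adj] {μ : ℝ} {x : V → ℝ}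
    (hμ : 0 < μ) (hx : x ≠ 0)
    (h : ∀ v, ∑ w ∈ G.neighborFinset v, (x v + x w) = μ * x v) :
    ∃ u v, G.Adj u v ∧ 0 < |x u + x v| ∧
      ∀ a b, G.Adj a b → |x a + x b| ≤ |x u + x v| := by
  obtain ⟨a, ha⟩ := Function.ne_iff.1 hx
  obtain ⟨b, hb, hab⟩ := Finset.exists_ne_zero_of_sum_ne_zero
    ((h a).trans_ne (mul_ne_zero hμ.ne' ha))
  have hadj : G.Adj a b := (G.mem_neighborFinset a b).1 hb
  obtain ⟨⟨u, v⟩, huv, hmax⟩ := Set.exists_max_image {p : V × V | G.Adj p.1 p.2}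
    (fun p => |x p.1 + x p.2|) (Set.toFinite _) ⟨(a, b), hadj⟩
  exact ⟨u, v, huv, (abs_pos.2 hab).trans_le (hmax (a, b) hadj), fun c d hcd => hmax (c, d) hcd⟩

variable [DecidableEq V]

theorem signlessLapMatrix_mulVec_apply_s8 (G : SimpleGraph V) [DecidableRel G.Adj]
    (x : V → ℝ) (v : V) :
    (signlessLapMatrix G).mulVec x v = ∑ w ∈ G.neighborFinset v, (x v + x w) := by
  have h : signlessLapMatrix G =
      Matrix.diagonal (fun v => (G.degree v : ℝ)) + G.adjMatrix ℝ := by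
    unfold signlessLapMatrix
    congr!
  rw [h, Matrix.add_mulVec, Pi.add_apply, Matrix.mulVec_diagonal,
    SimpleGraph.adjMatrix_mulVec_apply, Finset.sum_add_distrib, Finset.sum_const,
    SimpleGraph.card_neighborFinset_eq_degree, nsmul_eq_mul]

theorem mem_spectrum_signlessLapMatrix_iff (G : SimpleGraph V) [DecidableRel G.Adj] (μ : ℝ) :
    μ ∈ spectrum ℝ (signlessLapMatrix G) ↔
      ∃ x : V → ℝ, x ≠ 0 ∧ ∀ v, ∑ w ∈ G.neighborFinset v, (x v + x w) = μ * x v := by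
  rw [← Matrix.spectrum_toLin', ← Module.End.hasEigenvalue_iff_mem_spectrum]
  constructor
  · intro h
    obtain ⟨x, hx⟩ := h.exists_hasEigenvector
    refine ⟨x, hx.2, fun v => ?_⟩
    rw [← signlessLapMatrix_mulVec_apply_s8, ← Matrix.toLin'_apply, hx.apply_eq_smul]
    rfl
  · rintro ⟨x, hx, h⟩
    refine Module.End.hasEigenvalue_of_hasEigenvector (x := x) ⟨?_, hx⟩
    rw [Module.End.mem_eigenspace_iff, Matrix.toLin'_apply]
    ext v
    rw [signlessLapMatrix_mulVec_apply_s8, h]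
    rfl

theorem le_of_mem_spectrum_signlessLapMatrix (G : SimpleGraph V) [DecidableRel G.Adj]
    {μ M : ℝ} (hM0 : 0 ≤ M) (hM : ∀ u v, G.Adj u v → (G.degree u : ℝ) + G.degree v ≤ M)
    (hμ : μ ∈ spectrum ℝ (signlessLapMatrix G)) : μ ≤ M := by
  rcases le_or_gt μ 0 with h0 | h0
  · exact h0.trans hM0
  obtain ⟨x, hx, h⟩ := (mem_spectrum_signlessLapMatrix_iff G μ).1 hμ
  obtain ⟨u, v, huv, hpos, hmax⟩ := exists_adj_abs_add_max G h0 hx h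
  refine le_of_mul_le_mul_right ?_ hpos
  have h1 := mul_abs_add_le_sum G h u v
  have h2 := sum_abs_add_le G hmax u
  have h3 := sum_abs_add_le G hmax v
  have h4 := mul_le_mul_of_nonneg_right (hM u v huv) hpos.le
  linarith

theorem degree_add_degree_eq_of_mem_spectrum (G : SimpleGraph V) [DecidableRel G.Adj]
    (hG : G.Connected) {M : ℝ} (hM0 : 0 < M)
    (hM : ∀ u v, G.Adj u v → (G.degree u : ℝ) + G.degree v ≤ M)
    (hμ : M ∈ spectrum ℝ (signlessLapMatrix G)) {u v : V} (huv : G.Adj u v) :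
    (G.degree u : ℝ) + G.degree v = M := by
  obtain ⟨x, hx, h⟩ := (mem_spectrum_signlessLapMatrix_iff G M).1 hμ
  obtain ⟨u₀, v₀, huv₀, hpos, hmax⟩ := exists_adj_abs_add_max G hM0 hx h
  obtain ⟨Y, hY⟩ : ∃ Y, |x u₀ + x v₀| = Y := ⟨_, rfl⟩
  rw [hY] at hpos hmax
  have sum_eq : ∀ a b, G.Adj a b → |x a + x b| = Y →
      (G.degree a : ℝ) + G.degree b = M ∧
        ∑ w ∈ G.neighborFinset b, |x b + x w| = ∑ w ∈ G.neighborFinset b, Y := by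
    intro a b hab he
    have h1 := mul_abs_add_le_sum G h a b
    rw [he] at h1
    have h2 := sum_abs_add_le G hmax a
    have h3 := sum_abs_add_le G hmax b
    have h4 := mul_le_mul_of_nonneg_right (hM a b hab) hpos.le
    refine ⟨(hM a b hab).antisymm (le_of_mul_le_mul_right ?_ hpos), ?_⟩
    · linarith
    · rw [Finset.sum_const, SimpleGraph.card_neighborFinset_eq_degree, nsmul_eq_mul]
      linarith
  have step : ∀ a b, G.Adj a b → |x a + x b| = Y → ∀ w, G.Adj b w → |x b + x w| = Y := by
    intro a b hab he w hw
    exact (Finset.sum_eq_sum_iff_of_le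
      (fun i hi => hmax b i ((G.mem_neighborFinset b i).1 hi))).1 (sum_eq a b hab he).2 w
      ((G.mem_neighborFinset b w).2 hw)
  have all : ∀ a w, G.Adj a w → |x a + x w| = Y := by
    intro a
    refine Relation.ReflTransGen.head_induction_on
      ((G.reachable_iff_reflTransGen a v₀).1 (hG.preconnected a v₀)) (step u₀ v₀ huv₀ hY) ?_
    intro a b hab _ ih
    exact step b a hab.symm (ih a hab.symm)
  exact (sum_eq u v huv (all u v huv)).1

theorem mem_spectrum_of_degree_add_degree_eq (G : SimpleGraph V) [DecidableRel G.Adj]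
    (he : ∃ u v, G.Adj u v) {M : ℝ}
    (hM : ∀ u v, G.Adj u v → (G.degree u : ℝ) + G.degree v = M) :
    M ∈ spectrum ℝ (signlessLapMatrix G) := by
  refine (mem_spectrum_signlessLapMatrix_iff G M).2 ⟨fun v => (G.degree v : ℝ), ?_, fun v => ?_⟩
  · obtain ⟨u, v, huv⟩ := he
    refine Function.ne_iff.2 ⟨u, ?_⟩
    have : 0 < G.degree u := (G.degree_pos_iff_exists_adj u).2 ⟨v, huv⟩
    exact Nat.cast_ne_zero.2 this.ne'
  · rw [Finset.sum_congr rfl fun w hw => hM v w ((G.mem_neighborFinset v w).1 hw),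
      Finset.sum_const, SimpleGraph.card_neighborFinset_eq_degree, nsmul_eq_mul, mul_comm]

end SignlessLaplacian

theorem stmt8 {V : Type*} [Fintype V] [DecidableEq V]
    (G : SimpleGraph V) [DecidableRel G.Adj] (he : ∃ u v, G.Adj u v) :
    qSpecRad G ≤
      sSup {x : ℝ | ∃ u v, G.Adj u v ∧ x = (G.degree u : ℝ) + (G.degree v : ℝ)} ∧
    (G.Connected →
      (qSpecRad G =
          sSup {x : ℝ | ∃ u v, G.Adj u v ∧ x = (G.degree u : ℝ) + (G.degree v : ℝ)} ↔
        IsRegularGraph G ∨ IsSemiregularBipartite G)) := by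
  classical
  obtain ⟨M, hMdef⟩ : ∃ M, sSup {x : ℝ | ∃ u v, G.Adj u v ∧
      x = (G.degree u : ℝ) + (G.degree v : ℝ)} = M := ⟨_, rfl⟩
  rw [hMdef]
  have hfin : {x : ℝ | ∃ u v, G.Adj u v ∧
      x = (G.degree u : ℝ) + (G.degree v : ℝ)}.Finite := by
    refine (Set.finite_range fun p : V × V => (G.degree p.1 : ℝ) + G.degree p.2).subset ?_
    rintro x ⟨u, v, -, rfl⟩
    exact ⟨(u, v), rfl⟩
  have hM : ∀ u v, G.Adj u v → (G.degree u : ℝ) + G.degree v ≤ M := fun u v huv =>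
    hMdef ▸ le_csSup hfin.bddAbove ⟨u, v, huv, rfl⟩
  have hM0 : 0 < M := by
    obtain ⟨u, v, huv⟩ := he
    have hu : 0 < G.degree u := (G.degree_pos_iff_exists_adj u).2 ⟨v, huv⟩
    exact (add_pos_of_pos_of_nonneg (Nat.cast_pos.2 hu) (Nat.cast_nonneg _)).trans_le
      (hM u v huv)
  have hle : ∀ μ ∈ spectrum ℝ (signlessLapMatrix G), μ ≤ M := fun μ hμ =>
    le_of_mem_spectrum_signlessLapMatrix G hM0.le hM hμ
  refine ⟨Real.sSup_le hle hM0.le, fun hG => ?_⟩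
  rw [← exists_degree_add_degree_eq_iff G hG]
  constructor
  · intro hq
    have hne : (spectrum ℝ (signlessLapMatrix G)).Nonempty := by
      by_contra hne
      rw [Set.not_nonempty_iff_eq_empty] at hne
      rw [qSpecRad, hne, Real.sSup_empty] at hq
      exact hM0.ne hq
    have hmem : M ∈ spectrum ℝ (signlessLapMatrix G) :=
      hq ▸ hne.csSup_mem (Matrix.finite_real_spectrum)
    have hall : ∀ u v, G.Adj u v → (G.degree u : ℝ) + G.degree v = M := fun u v huv =>
      degree_add_degree_eq_of_mem_spectrum G hG hM0 hM hmem huv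
    obtain ⟨u, v, huv⟩ := he
    refine ⟨G.degree u + G.degree v, fun a b hab => ?_⟩
    exact_mod_cast (hall a b hab).trans (hall u v huv).symm
  · rintro ⟨N, hN⟩
    have hN' : ∀ u v, G.Adj u v → (G.degree u : ℝ) + G.degree v = N := fun u v huv => by
      exact_mod_cast hN u v huv
    have hMN : M ≤ N := by
      obtain ⟨u, v, huv⟩ := he
      refine hMdef ▸ csSup_le ⟨_, u, v, huv, rfl⟩ ?_
      rintro x ⟨a, b, hab, rfl⟩
      exact (hN' a b hab).le
    exact (Real.sSup_le hle hM0.le).antisymm (hMN.trans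
      (le_csSup ⟨M, hle⟩ (mem_spectrum_of_degree_add_degree_eq G he hN')))
end

section
/- For a finite simple graph G, the signless Laplacian matrix Q(G) and the Laplacian matrix L(G) have the same spectrum (the same multiset of eigenvalues, counted with multiplicity) if and only if G is bipartite. -/
open SimpleGraph Finset

theorem Matrix.IsHermitian.rank_eq_of_charpoly_eq {n : Type*} [Fintype n] [DecidableEq n]
    {A B : Matrix n n ℝ} (hA : A.IsHermitian) (hB : B.IsHermitian)
    (h : A.charpoly = B.charpoly) : A.rank = B.rank := by
  have he := (hA.eigenvalues_eq_eigenvalues_iff hB).mpr h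
  rw [hA.rank_eq_card_non_zero_eigs, hB.rank_eq_card_non_zero_eigs, he]

theorem Matrix.finrank_ker_toLin'_eq_of_rank_eq {n : Type*} [Fintype n] [DecidableEq n]
    {A B : Matrix n n ℝ} (h : A.rank = B.rank) :
    Module.finrank ℝ (LinearMap.ker A.toLin') = Module.finrank ℝ (LinearMap.ker B.toLin') := by
  have hA := LinearMap.finrank_range_add_finrank_ker A.toLin'
  have hB := LinearMap.finrank_range_add_finrank_ker B.toLin'
  rw [Matrix.rank_eq_finrank_range_toLin A (Pi.basisFun ℝ n) (Pi.basisFun ℝ n),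
    Matrix.rank_eq_finrank_range_toLin B (Pi.basisFun ℝ n) (Pi.basisFun ℝ n),
    Matrix.toLin_eq_toLin'] at h
  omega

section

variable {V : Type*} [Fintype V] [DecidableEq V] (G : SimpleGraph V) [DecidableRel G.Adj]

theorem signlessLapMatrix_eq : signlessLapMatrix G = G.degMatrix ℝ + G.adjMatrix ℝ := by
  unfold signlessLapMatrix SimpleGraph.degMatrix
  congr!

theorem isHermitian_signlessLapMatrix : (signlessLapMatrix G).IsHermitian := by
  rw [signlessLapMatrix_eq]
  exact (G.isHermitian_degMatrix ℝ).add (G.isHermitian_adjMatrix ℝ)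

theorem dotProduct_mulVec_signlessLapMatrix (x : V → ℝ) :
    x ⬝ᵥ (signlessLapMatrix G).mulVec x =
      (∑ i : V, ∑ j : V, if G.Adj i j then (x i + x j) ^ 2 else 0) / 2 := by
  simp_rw [signlessLapMatrix_eq, Matrix.add_mulVec, dotProduct_add, dotProduct_mulVec_degMatrix,
    dotProduct_mulVec_adjMatrix, ← sum_add_distrib, degree_eq_sum_if_adj, sum_mul, ite_mul,
    one_mul, zero_mul, ← sum_add_distrib, ite_add_ite, add_zero]
  rw [← add_self_div_two (∑ x_1 : V, ∑ x_2 : V, _)]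
  conv_lhs => enter [1, 2, 2, i, 2, j]; rw [if_congr (adj_comm G i j) rfl rfl]
  conv_lhs => enter [1, 2]; rw [Finset.sum_comm]
  simp_rw [← sum_add_distrib, ite_add_ite]
  congr 2 with i
  congr 2 with j
  ring_nf

variable {G}

theorem eq_neg_of_signlessLapMatrix_mulVec_eq_zero {x : V → ℝ}
    (hx : (signlessLapMatrix G).mulVec x = 0) {i j : V} (hij : G.Adj i j) : x i = -x j := by
  have h := dotProduct_mulVec_signlessLapMatrix G x
  rw [hx, dotProduct_zero, eq_comm] at h
  have h' : ∀ i j : V, G.Adj i j → x i + x j = 0 := by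
    simpa (disch := intros; positivity) [sum_eq_zero_iff_of_nonneg] using h
  exact eq_neg_of_add_eq_zero_left (h' i j hij)

theorem abs_eq_of_reachable_of_signlessLapMatrix_mulVec_eq_zero {x : V → ℝ}
    (hx : (signlessLapMatrix G).mulVec x = 0) {i j : V} (hij : G.Reachable i j) :
    |x i| = |x j| := by
  obtain ⟨w⟩ := hij
  induction w with
  | nil => rfl
  | cons h _ ih =>
    rw [← ih, eq_neg_of_signlessLapMatrix_mulVec_eq_zero hx h, abs_neg]

theorem colorable_two_of_signlessLapMatrix_mulVec_eq_zero {x : V → ℝ}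
    (hx : (signlessLapMatrix G).mulVec x = 0) (hx0 : ∀ v, x v ≠ 0) : G.Colorable 2 := by
  refine (SimpleGraph.Coloring.mk (fun v => decide (0 < x v)) ?_ : G.Coloring Bool).colorable
  intro v w hvw h
  have hneg := eq_neg_of_signlessLapMatrix_mulVec_eq_zero hx hvw
  have hiff : 0 < x v ↔ 0 < x w := by simpa using h
  rcases lt_or_gt_of_ne (hx0 v) with hv | hv
  · have := hiff.mpr (by linarith)
    linarith
  · have := hiff.mp hv
    linarith

variable (G)

theorem colorable_two_of_finrank_ker_signlessLapMatrix
    (h : Module.finrank ℝ (LinearMap.ker (signlessLapMatrix G).toLin') =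
      Fintype.card G.ConnectedComponent) : G.Colorable 2 := by
  let f : LinearMap.ker (signlessLapMatrix G).toLin' →ₗ[ℝ] (G.ConnectedComponent → ℝ) :=
    (LinearMap.funLeft ℝ ℝ fun c : G.ConnectedComponent => Quot.out c) ∘ₗ Submodule.subtype _
  have hker (x : LinearMap.ker (signlessLapMatrix G).toLin') :
      (signlessLapMatrix G).mulVec x = 0 := x.2
  have habs (x : LinearMap.ker (signlessLapMatrix G).toLin') (v : V) :
      |(x : V → ℝ) v| = |f x (G.connectedComponentMk v)| :=
    abs_eq_of_reachable_of_signlessLapMatrix_mulVec_eq_zero (hker x)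
      (SimpleGraph.ConnectedComponent.exact (Quot.out_eq (G.connectedComponentMk v)).symm)
  have hinj : Function.Injective f := by
    rw [injective_iff_map_eq_zero]
    intro x hx
    ext v
    simpa [hx] using habs x v
  have hsurj : Function.Surjective f :=
    (LinearMap.injective_iff_surjective_of_finrank_eq_finrank
      (by rw [h, Module.finrank_fintype_fun_eq_card])).mp hinj
  obtain ⟨x, hx⟩ := hsurj fun _ => 1
  refine colorable_two_of_signlessLapMatrix_mulVec_eq_zero (hker x) fun v hv => ?_
  simpa [hx, hv] using habs x v

variable {G}

theorem charpoly_signlessLapMatrix_eq_of_colorable_two (h : G.Colorable 2) :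
    (signlessLapMatrix G).charpoly = (G.lapMatrix ℝ).charpoly := by
  obtain ⟨c⟩ := h
  let s : V → ℝ := fun v => if c v = 0 then 1 else -1
  have hs (v : V) : s v * s v = 1 := by simp only [s]; split_ifs <;> norm_num
  have hadj {v w : V} (hvw : G.Adj v w) : s v * s w = -1 := by
    have := c.valid hvw
    simp only [s]
    split_ifs <;> first | omega | norm_num
  have hconj : signlessLapMatrix G =
      Matrix.diagonal s * (G.lapMatrix ℝ * Matrix.diagonal s) := by
    ext v w
    rw [signlessLapMatrix_eq, Matrix.diagonal_mul, Matrix.mul_diagonal]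
    simp only [SimpleGraph.lapMatrix, SimpleGraph.degMatrix, Matrix.add_apply, Matrix.sub_apply,
      adjMatrix_apply, Matrix.diagonal_apply]
    by_cases hvw : v = w
    · subst hvw
      simp only [if_true, SimpleGraph.irrefl, if_false]
      linear_combination (-(G.degree v : ℝ)) * hs v
    · by_cases ha : G.Adj v w
      · simp only [hvw, ha, if_true, if_false]
        linear_combination hadj ha
      · simp [hvw, ha]
  rw [hconj, Matrix.charpoly_mul_comm, Matrix.mul_assoc, Matrix.diagonal_mul_diagonal]
  simp [hs]

end

theorem stmt9 {V : Type*} [Fintype V] [DecidableEq V]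
    (G : SimpleGraph V) [DecidableRel G.Adj] :
    (signlessLapMatrix G).charpoly = (G.lapMatrix ℝ).charpoly ↔ G.Colorable 2 := by
  refine ⟨fun h => colorable_two_of_finrank_ker_signlessLapMatrix G ?_,
    charpoly_signlessLapMatrix_eq_of_colorable_two⟩
  rw [card_connectedComponent_eq_finrank_ker_toLin'_lapMatrix]
  exact Matrix.finrank_ker_toLin'_eq_of_rank_eq
    ((isHermitian_signlessLapMatrix G).rank_eq_of_charpoly_eq (G.isHermitian_lapMatrix ℝ) h)
end

section
/- If G is a simple graph of order n ≥ 2, then μ(G) ≤ n, with equality if and only if the complement of G is disconnected. -/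
open SimpleGraph Finset

theorem Matrix.mem_spectrum_iff_exists_mulVec_eq {K n : Type*} [Field K] [Fintype n]
    [DecidableEq n] {M : Matrix n n K} {c : K} :
    c ∈ spectrum K M ↔ ∃ x : n → K, x ≠ 0 ∧ M.mulVec x = c • x := by
  rw [← Matrix.spectrum_toLin', ← Module.End.hasEigenvalue_iff_mem_spectrum]
  constructor
  · intro h
    obtain ⟨x, hx⟩ := h.exists_hasEigenvector
    exact ⟨x, hx.2, by simpa using hx.apply_eq_smul⟩
  · rintro ⟨x, hx0, hx⟩
    exact Module.End.hasEigenvalue_of_hasEigenvector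
      ⟨Module.End.mem_eigenspace_iff.2 (by simpa using hx), hx0⟩

namespace SimpleGraph

variable {V : Type*} [Fintype V] [DecidableEq V] (G : SimpleGraph V) [DecidableRel G.Adj]

theorem lapMatrix_mulVec_apply_eq_sum (x : V → ℝ) (v : V) :
    (G.lapMatrix ℝ).mulVec x v = ∑ u, if G.Adj v u then x v - x u else 0 := by
  rw [lapMatrix_mulVec_apply, ← Finset.sum_filter, Finset.sum_sub_distrib,
    ← neighborFinset_eq_filter]
  simp

theorem lapMatrix_mulVec_add_lapMatrix_compl_mulVec (x : V → ℝ) :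
    (G.lapMatrix ℝ).mulVec x + (Gᶜ.lapMatrix ℝ).mulVec x =
      fun v => Fintype.card V * x v - ∑ u, x u := by
  ext v
  have h (u : V) : (if G.Adj v u then x v - x u else 0) +
      (if Gᶜ.Adj v u then x v - x u else 0) = x v - x u := by
    by_cases huv : v = u
    · simp [huv]
    · by_cases ha : G.Adj v u <;> simp [huv, ha]
  rw [Pi.add_apply, lapMatrix_mulVec_apply_eq_sum, lapMatrix_mulVec_apply_eq_sum,
    ← Finset.sum_add_distrib, Finset.sum_congr rfl fun u _ => h u]
  simp

theorem sum_lapMatrix_mulVec (x : V → ℝ) : ∑ v, (G.lapMatrix ℝ).mulVec x v = 0 := by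
  have h : (G.lapMatrix ℝ).vecMul (fun _ => 1) = 0 := by
    rw [← Matrix.mulVec_transpose, G.isSymm_lapMatrix ℝ, lapMatrix_mulVec_const_eq_zero]
  have := Matrix.dotProduct_mulVec (fun _ => (1 : ℝ)) (G.lapMatrix ℝ) x
  rw [h] at this
  simpa [dotProduct] using this

theorem sum_eq_zero_of_lapMatrix_mulVec_eq_smul {c : ℝ} (hc : c ≠ 0) {x : V → ℝ}
    (hx : (G.lapMatrix ℝ).mulVec x = c • x) : ∑ v, x v = 0 := by
  have h := G.sum_lapMatrix_mulVec x
  simpa [hx, ← Finset.mul_sum, hc] using h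

theorem lapMatrix_compl_mulVec_of_lapMatrix_mulVec_eq_smul {c : ℝ} (hc : c ≠ 0) {x : V → ℝ}
    (hx : (G.lapMatrix ℝ).mulVec x = c • x) :
    (Gᶜ.lapMatrix ℝ).mulVec x = (Fintype.card V - c) • x := by
  have h := G.lapMatrix_mulVec_add_lapMatrix_compl_mulVec x
  rw [hx, G.sum_eq_zero_of_lapMatrix_mulVec_eq_smul hc hx] at h
  ext v
  have hv := congrFun h v
  simp only [Pi.add_apply, Pi.smul_apply, smul_eq_mul] at hv ⊢
  linarith

theorem le_card_of_mem_spectrum_lapMatrix {c : ℝ} (hc : c ∈ spectrum ℝ (G.lapMatrix ℝ)) :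
    c ≤ Fintype.card V := by
  obtain rfl | hc0 := eq_or_ne c 0
  · positivity
  obtain ⟨x, hx0, hx⟩ := Matrix.mem_spectrum_iff_exists_mulVec_eq.1 hc
  have hpos := (posSemidef_lapMatrix ℝ Gᶜ).dotProduct_mulVec_nonneg x
  rw [G.lapMatrix_compl_mulVec_of_lapMatrix_mulVec_eq_smul hc0 hx, dotProduct_smul,
    star_trivial, smul_eq_mul] at hpos
  have hxx : 0 < x ⬝ᵥ x := by
    simpa using Matrix.dotProduct_star_self_pos_iff.2 hx0
  exact sub_nonneg.1 (nonneg_of_mul_nonneg_left hpos hxx)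

theorem card_mem_spectrum_lapMatrix_iff [Nonempty V] :
    (Fintype.card V : ℝ) ∈ spectrum ℝ (G.lapMatrix ℝ) ↔ ¬ Gᶜ.Connected := by
  have hcard : (Fintype.card V : ℝ) ≠ 0 := by simp
  rw [Matrix.mem_spectrum_iff_exists_mulVec_eq]
  constructor
  · rintro ⟨x, hx0, hx⟩ hconn
    have hker := G.lapMatrix_compl_mulVec_of_lapMatrix_mulVec_eq_smul hcard hx
    rw [sub_self, zero_smul, lapMatrix_mulVec_eq_zero_iff_forall_reachable] at hker
    have hsum := G.sum_eq_zero_of_lapMatrix_mulVec_eq_smul hcard hx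
    refine hx0 (funext fun v => ?_)
    rw [Finset.sum_congr rfl fun u _ => hker u v (hconn.preconnected u v)] at hsum
    simpa using hsum
  · intro hconn
    obtain ⟨a, b, hab⟩ : ∃ a b, ¬ Gᶜ.Reachable a b := by
      by_contra! h
      exact hconn ⟨h⟩
    classical
    let y : V → ℝ := fun v => if Gᶜ.Reachable a v then 1 else 0
    let x : V → ℝ := fun v => y v - (∑ u, y u) / Fintype.card V
    have hsum : ∑ v, x v = 0 := by
      simp only [x, Finset.sum_sub_distrib, Finset.sum_const, Finset.card_univ, nsmul_eq_mul]
      rw [mul_div_cancel₀ _ hcard, sub_self]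
    have hker : (Gᶜ.lapMatrix ℝ).mulVec x = 0 := by
      rw [lapMatrix_mulVec_eq_zero_iff_forall_reachable]
      intro i j hij
      have : Gᶜ.Reachable a i ↔ Gᶜ.Reachable a j :=
        ⟨fun h => h.trans hij, fun h => h.trans hij.symm⟩
      simp only [x, y, this]
    refine ⟨x, fun h0 => ?_, ?_⟩
    · have : y a = y b := sub_left_injective ((congrFun h0 a).trans (congrFun h0 b).symm)
      simp [y, hab] at this
    · have h := G.lapMatrix_mulVec_add_lapMatrix_compl_mulVec x
      rw [hker, hsum, add_zero] at h
      simpa [funext_iff] using h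

theorem spectrum_lapMatrix_nonempty [Nonempty V] : (spectrum ℝ (G.lapMatrix ℝ)).Nonempty := by
  refine ⟨0, Matrix.mem_spectrum_iff_exists_mulVec_eq.2 ⟨fun _ => 1, ?_, ?_⟩⟩
  · exact Function.const_ne_zero.2 one_ne_zero
  · rw [lapMatrix_mulVec_const_eq_zero, zero_smul]

end SimpleGraph

theorem stmt10 {V : Type*} [Fintype V] [DecidableEq V] (G : SimpleGraph V)
    (hn : 2 ≤ Fintype.card V) :
    muSpecRad G ≤ Fintype.card V ∧
    (muSpecRad G = Fintype.card V ↔ ¬ Gᶜ.Connected) := by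
  have : Nonempty V := Fintype.card_pos_iff.1 (by omega)
  let _ := Classical.decRel G.Adj
  have hle : ∀ c ∈ spectrum ℝ (G.lapMatrix ℝ), c ≤ Fintype.card V :=
    fun c hc => G.le_card_of_mem_spectrum_lapMatrix hc
  have hne := G.spectrum_lapMatrix_nonempty
  refine ⟨csSup_le hne hle, ?_⟩
  rw [← G.card_mem_spectrum_lapMatrix_iff]
  refine ⟨fun h => h ▸ hne.csSup_mem (Matrix.finite_spectrum _), fun h => ?_⟩
  exact IsGreatest.csSup_eq ⟨h, hle⟩
end

section
/- For all integers n ≥ 3 and 0 ≤ c ≤ ⌊(n-1)/2⌋, the graph F_{n,c} contains no chorded cycle. -/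
open SimpleGraph Finset

/-- If `xy` is not an edge of a cycle through `x`, then `x` has two neighbors other than `y`. -/
lemma SimpleGraph.Walk.IsCycle.exists_two_adj_of_notMem_edges {V : Type*} {G : SimpleGraph V} {v : V}
    {C : G.Walk v v} (hC : C.IsCycle) {x y : V} (hx : x ∈ C.support)
    (hxy : s(x, y) ∉ C.edges) :
    ∃ p q, p ≠ q ∧ p ≠ y ∧ q ≠ y ∧ G.Adj x p ∧ G.Adj x q := by
  obtain ⟨p, q, hpq, hN⟩ := Set.ncard_eq_two.mp (hC.ncard_neighborSet_toSubgraph_eq_two hx)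
  have hp : C.toSubgraph.Adj x p := by
    rw [← Subgraph.mem_neighborSet, hN]; simp
  have hq : C.toSubgraph.Adj x q := by
    rw [← Subgraph.mem_neighborSet, hN]; simp
  refine ⟨p, q, hpq, ?_, ?_, hp.adj_sub, hq.adj_sub⟩
  · rintro rfl
    exact hxy (C.mem_edges_toSubgraph.mp hp)
  · rintro rfl
    exact hxy (C.mem_edges_toSubgraph.mp hq)

/-- A leaf of the star has at most two neighbors in `Fgraph n c`. -/
lemma Fgraph_not_three_adj {n c : ℕ} {x p q r : Fin n} (hx : x.val ≠ 0)
    (hpq : p ≠ q) (hpr : p ≠ r) (hqr : q ≠ r) (hp : (Fgraph n c).Adj x p)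
    (hq : (Fgraph n c).Adj x q) (hr : (Fgraph n c).Adj x r) : False := by
  simp only [Fgraph, SimpleGraph.fromRel_adj, ne_eq, Fin.ext_iff] at *
  omega

theorem stmt15 (n c : ℕ) (hn : 3 ≤ n) (hc : c ≤ (n - 1) / 2) :
    ¬ HasChordedCycle (Fgraph n c) := by
  rintro ⟨v, C, hC, a, b, ha, hb, hab, hchord⟩
  by_cases h0 : a.val = 0
  · have hb0 : b.val ≠ 0 := fun h => hab.ne (Fin.ext (h0.trans h.symm))
    obtain ⟨p, q, hpq, hpa, hqa, hp, hq⟩ :=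
      hC.exists_two_adj_of_notMem_edges hb (by rwa [Sym2.eq_swap])
    exact Fgraph_not_three_adj hb0 hpq hpa hqa hp hq hab.symm
  · obtain ⟨p, q, hpq, hpb, hqb, hp, hq⟩ := hC.exists_two_adj_of_notMem_edges ha hchord
    exact Fgraph_not_three_adj h0 hpq hpb hqb hp hq hab
end

section
/- Let G be a simple graph of order n ≥ 4 that contains a vertex u adjacent to all other vertices. If G contains no chorded cycle, then G is isomorphic to F_{n,c} for some c with 0 ≤ c ≤ ⌊(n-1)/2⌋; equivalently, the subgraph of G induced on N(u) is a disjoint union of isolated vertices and independent edges. -/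
open SimpleGraph Finset

theorem hasChordedCycle_of_path_in_neighborhood {V : Type*} {G : SimpleGraph V} {u a b c : V}
    (hua : G.Adj u a) (hub : G.Adj u b) (huc : G.Adj u c) (hba : G.Adj b a) (hbc : G.Adj b c)
    (hac : a ≠ c) : HasChordedCycle G := by
  refine ⟨u, .cons hua (.cons hba.symm (.cons hbc (.cons huc.symm .nil))), ?_, u, b, ?_, ?_, hub, ?_⟩
  · have h₁ := hua.ne
    have h₂ := hub.ne
    have h₃ := huc.ne
    have h₄ := hba.ne
    have h₅ := hbc.ne
    rw [Walk.cons_isCycle_iff]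
    simp [Walk.isPath_def]
    grind
  · simp
  · simp
  · have h₁ := hua.ne
    have h₂ := hub.ne
    have h₃ := huc.ne
    have h₄ := hba.ne
    have h₅ := hbc.ne
    simp
    grind

theorem Finset.exists_injOn_lt_card {α : Type*} [DecidableEq α] (s : Finset α) :
    ∃ e : α → ℕ, Set.InjOn e s ∧ ∀ v ∈ s, e v < #s := by
  refine ⟨fun v => if h : v ∈ s then s.equivFin ⟨v, h⟩ else 0, fun v hv w hw h => ?_,
    fun v hv => by simp [hv]⟩
  rw [mem_coe] at hv hw
  simp only [hv, hw, dite_true] at h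
  simpa using s.equivFin.injective (Fin.ext h)

/-- A dominating vertex whose neighborhood induces a matching comes with an involution that
exchanges the ends of each matching edge and fixes every other vertex. -/
theorem exists_involutive_adj_iff {V : Type*} {G : SimpleGraph V} {u : V}
    (hu : ∀ v, v ≠ u → G.Adj u v)
    (hN : ∀ a b c, G.Adj u a → G.Adj u b → G.Adj u c → G.Adj b a → G.Adj b c → a = c) :
    ∃ p : V → V, p.Involutive ∧ p u = u ∧
      ∀ v w, G.Adj v w ↔ v ≠ w ∧ (v = u ∨ w = u ∨ p v = w) := by
  classical
  let p : V → V := fun v => if h : v ≠ u ∧ ∃ w, w ≠ u ∧ G.Adj v w then h.2.choose else v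
  have hp : ∀ v w, v ≠ u → w ≠ u → G.Adj v w → p v = w := by
    intro v w hv hw hvw
    have h : v ≠ u ∧ ∃ w, w ≠ u ∧ G.Adj v w := ⟨hv, w, hw, hvw⟩
    have hs := h.2.choose_spec
    simp only [p, dif_pos h]
    exact hN _ v _ (hu _ hs.1) (hu _ hv) (hu _ hw) hs.2 hvw
  have hp' : ∀ v, p v = v ∨ (v ≠ u ∧ p v ≠ u ∧ G.Adj v (p v)) := by
    intro v
    by_cases h : v ≠ u ∧ ∃ w, w ≠ u ∧ G.Adj v w
    · have hs := h.2.choose_spec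
      right
      simp only [p, dif_pos h]
      exact ⟨h.1, hs⟩
    · left
      simp only [p, dif_neg h]
  refine ⟨p, fun v => ?_, ?_, fun v w => ⟨fun h => ⟨h.ne, ?_⟩, ?_⟩⟩
  · rcases hp' v with h | ⟨h₁, h₂, h₃⟩
    · rw [h, h]
    · exact hp _ _ h₂ h₁ h₃.symm
  · simp [p]
  · by_contra! hc
    exact hc.2.2 (hp v w hc.1 hc.2.1 h)
  · rintro ⟨hne, rfl | rfl | rfl⟩
    · exact hu _ hne.symm
    · exact (hu _ hne).symm
    · rcases hp' v with h | h
      · exact absurd h.symm hne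
      · exact h.2.2

theorem exists_iso_Fgraph_of_involutive {n : ℕ} {G : SimpleGraph (Fin n)} {u : Fin n}
    {p : Fin n → Fin n} (hp : p.Involutive) (hpu : p u = u)
    (hG : ∀ v w, G.Adj v w ↔ v ≠ w ∧ (v = u ∨ w = u ∨ p v = w)) :
    ∃ c ≤ (n - 1) / 2, Nonempty (G ≃g Fgraph n c) := by
  classical
  let A : Finset (Fin n) := {v | v < p v}
  let B : Finset (Fin n) := {v | p v < v}
  let R : Finset (Fin n) := {v | p v = v ∧ v ≠ u}
  have hA : ∀ v, v ∈ A ↔ v < p v := by simp [A]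
  have hB : ∀ v, v ∈ B ↔ p v < v := by simp [B]
  have hR : ∀ v, v ∈ R ↔ p v = v ∧ v ≠ u := by simp [R]
  have hAB : #A = #B := by
    refine card_bij (fun v _ => p v) ?_ (fun _ _ _ _ h => hp.injective h)
      fun v hv => ⟨p v, ?_, hp v⟩
    · simp [hA, hB, hp _]
    · simpa [hA, hB, hp _] using hv
  have hcard : 1 + (2 * #A + #R) = n := by
    have huniv : insert u (A ∪ B ∪ R) = univ := by
      ext v
      simp only [mem_insert, mem_union, hA, hB, hR, mem_univ, iff_true]
      grind
    have h₁ : Disjoint A B := disjoint_left.2 fun v => by simp only [hA, hB]; grind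
    have h₂ : Disjoint (A ∪ B) R := disjoint_left.2 fun v => by
      simp only [mem_union, hA, hB, hR]; grind
    have h₃ : u ∉ A ∪ B ∪ R := by simp [hA, hB, hR, hpu]
    have := congrArg card huniv
    rw [card_insert_of_notMem h₃, card_union_of_disjoint h₂, card_union_of_disjoint h₁,
      card_univ, Fintype.card_fin] at this
    lia
  obtain ⟨e, he, hec⟩ := A.exists_injOn_lt_card
  obtain ⟨r, hr, hrc⟩ := R.exists_injOn_lt_card
  let f : Fin n → ℕ := fun v =>
    if v = u then 0 else if v < p v then 2 * e v + 1 else if p v < v then 2 * e (p v) + 2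
      else 2 * #A + 1 + r v
  have hf : ∀ v, (v = u ∧ f v = 0) ∨ (v ≠ u ∧ v ∈ A ∧ f v = 2 * e v + 1 ∧ e v < #A) ∨
      (v ≠ u ∧ v ∈ B ∧ p v ∈ A ∧ f v = 2 * e (p v) + 2 ∧ e (p v) < #A) ∨
      (v ∈ R ∧ f v = 2 * #A + 1 + r v ∧ r v < #R) := by
    intro v
    by_cases hv : v = u
    · simp [f, hv]
    rcases lt_trichotomy v (p v) with h | h | h
    · have hvA := (hA v).2 h
      exact .inr <| .inl ⟨hv, hvA, by simp [f, hv, h], hec v hvA⟩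
    · have hvR := (hR v).2 ⟨h.symm, hv⟩
      exact .inr <| .inr <| .inr ⟨hvR, by simp [f, hv, ← h], hrc v hvR⟩
    · have hpA : p v ∈ A := by simpa [hA, hp v] using h
      exact .inr <| .inr <| .inl
        ⟨hv, (hB v).2 h, hpA, by simp [f, hv, h, h.not_gt], hec _ hpA⟩
  clear_value A B R f
  have hfn : ∀ v, f v < n := by
    intro v
    rcases hf v with h | h | h | h <;> lia
  have hfi : ∀ v w, f v = f w → v = w := by
    intro v w h
    rcases hf v with ⟨h₁, h₂⟩ | ⟨h₁, h₂, h₃, h₄⟩ | ⟨h₁, h₂, h₃, h₄, h₅⟩ | ⟨h₁, h₂, h₃⟩ <;>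
    rcases hf w with ⟨k₁, k₂⟩ | ⟨k₁, k₂, k₃, k₄⟩ | ⟨k₁, k₂, k₃, k₄, k₅⟩ | ⟨k₁, k₂, k₃⟩ <;>
    first
    | lia
    | exact h₁.trans k₁.symm
    | exact he h₂ k₂ (by lia)
    | exact hp.injective (he h₃ k₃ (by lia))
    | exact hr h₁ k₁ (by lia)
  have hpair : ∀ v w, v ≠ u → w ≠ u → v ≠ w →
      ((f w = f v + 1 ∧ f w % 2 = 0 ∧ f w ≤ 2 * #A) ↔ v ∈ A ∧ p v = w) := by
    intro v w hv hw hvw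
    constructor
    · rintro ⟨h₁, h₂, h₃⟩
      have hv' := hf v
      have hw' := hf w
      have : v ∈ A ∧ p w ∈ A ∧ e v = e (p w) := by grind
      exact ⟨this.1, by rw [he this.1 this.2.1 this.2.2, hp]⟩
    · rintro ⟨h, rfl⟩
      have hv' := hf v
      have hw' := hf (p v)
      rw [hA] at h
      simp only [hA, hB, hR, hp v] at hv' hw'
      lia
  let F : Fin n ≃ Fin n := Equiv.ofBijective (fun v => ⟨f v, hfn v⟩)
    (Finite.injective_iff_bijective.1 fun v w h => hfi v w (congrArg Fin.val h))
  refine ⟨#A, by lia, ⟨⟨F, fun {v w} => ?_⟩⟩⟩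
  rw [hG, Fgraph, fromRel_adj, F.injective.ne_iff]
  refine and_congr_right fun hvw => ?_
  change ((f v = 0 ∨ f w = f v + 1 ∧ f w % 2 = 0 ∧ f w ≤ 2 * #A) ∨
    (f w = 0 ∨ f v = f w + 1 ∧ f v % 2 = 0 ∧ f v ≤ 2 * #A)) ↔ _
  have h₀ : ∀ v, f v = 0 ↔ v = u := by grind
  rw [h₀, h₀]
  by_cases hv : v = u
  · simp [hv]
  by_cases hw : w = u
  · simp [hw]
  rw [hpair v w hv hw hvw, hpair w v hw hv (Ne.symm hvw)]
  have := hp v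
  have := hp w
  grind

theorem stmt18 (n : ℕ) (hn : 4 ≤ n) (G : SimpleGraph (Fin n)) (u : Fin n)
    (hu : ∀ v, v ≠ u → G.Adj u v) (hcc : ¬ HasChordedCycle G) :
    (∃ c ≤ (n - 1) / 2, Nonempty (G ≃g Fgraph n c)) ∧
    (∀ a b c : Fin n, G.Adj u a → G.Adj u b → G.Adj u c →
      G.Adj b a → G.Adj b c → a = c) := by
  have hN : ∀ a b c : Fin n, G.Adj u a → G.Adj u b → G.Adj u c →
      G.Adj b a → G.Adj b c → a = c := fun a b c hua hub huc hba hbc =>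
    of_not_not fun hac =>
      hcc (hasChordedCycle_of_path_in_neighborhood hua hub huc hba hbc hac)
  obtain ⟨p, hp, hpu, hG⟩ := exists_involutive_adj_iff hu hN
  exact ⟨exists_iso_Fgraph_of_involutive hp hpu hG, hN⟩
end

section
/- Let G be a connected simple graph of order n ≥ 4 with no chorded cycle, and suppose there is an edge uv of G with d(u) + d(v) ≥ n + 1, where d denotes vertex degree. Then u and v have exactly one common neighbor, and every vertex of G is a neighbor of u or of v (that is, V(G) = N(u) ∪ N(v)). -/
open SimpleGraph Finset

/-- Two distinct common neighbors of the ends of an edge give a chorded 4-cycle. -/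
theorem hasChordedCycle_of_two_common_neighbors {V : Type*} {G : SimpleGraph V} {u v w x : V}
    (huv : G.Adj u v) (huw : G.Adj u w) (hvw : G.Adj v w) (hux : G.Adj u x) (hvx : G.Adj v x)
    (hwx : w ≠ x) : HasChordedCycle G := by
  refine ⟨u, .cons huw (.cons hvw.symm (.cons hvx (.cons hux.symm .nil))), ?_,
    u, v, by simp, by simp, huv, ?_⟩
  · simp [Walk.cons_isCycle_iff, Walk.isPath_def, huv.ne, huv.ne', huw.ne, huw.ne',
      hvw.ne', hux.ne', hvx.ne, hwx]
  · simp [huv.ne, huv.ne', huw.ne, hvw.ne, hux.ne, hvx.ne]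

theorem stmt19 {V : Type*} [Fintype V] (G : SimpleGraph V) [DecidableRel G.Adj]
    (hconn : G.Connected) (hn : 4 ≤ Fintype.card V)
    (hcc : ¬ HasChordedCycle G) (u v : V) (huv : G.Adj u v)
    (hdeg : Fintype.card V + 1 ≤ G.degree u + G.degree v) :
    (∃! w, G.Adj u w ∧ G.Adj v w) ∧ (∀ x, G.Adj u x ∨ G.Adj v x) := by
  classical
  have h_subsingleton : ∀ w x, G.Adj u w ∧ G.Adj v w → G.Adj u x ∧ G.Adj v x → w = x := by
    intro w x hw hx
    by_contra hne
    exact hcc (hasChordedCycle_of_two_common_neighbors huv hw.1 hw.2 hx.1 hx.2 hne)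
  have h_inter : #(G.neighborFinset u ∩ G.neighborFinset v) ≤ 1 := by
    rw [Finset.card_le_one]
    intro a ha b hb
    simp only [Finset.mem_inter, mem_neighborFinset] at ha hb
    exact h_subsingleton a b ha hb
  have h_union : #(G.neighborFinset u ∪ G.neighborFinset v) ≤ Fintype.card V :=
    Finset.card_le_univ _
  have h_sum := Finset.card_union_add_card_inter (G.neighborFinset u) (G.neighborFinset v)
  simp only [card_neighborFinset_eq_degree] at h_sum
  constructor
  · obtain ⟨w, hw⟩ : (G.neighborFinset u ∩ G.neighborFinset v).Nonempty :=
      Finset.card_pos.mp (by lia)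
    simp only [Finset.mem_inter, mem_neighborFinset] at hw
    exact ⟨w, hw, fun x hx => h_subsingleton x w hx hw⟩
  · intro x
    have hx : x ∈ G.neighborFinset u ∪ G.neighborFinset v := by
      rw [(Finset.card_eq_iff_eq_univ (G.neighborFinset u ∪ G.neighborFinset v)).mp (by lia)]
      exact Finset.mem_univ x
    simpa using hx
end
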